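/- (Comparison principle for the obstacle level-set flow) Let u be a viscosity subsolution and v a viscosity supersolution of the level-set mean curvature flow with obstacles φ and ψ, with u(x,0) ≤ v(x,0) for all x ∈ Ω. Then u(x,t) ≤ v(x,t) for all (x,t) ∈ Ω × [0,∞). -/

import Mathlib

open MeasureTheory Filter Topology RealInnerProductSpace

noncomputable section

variable {d : ℕ}

/-- `ℤ^d`-periodicity. -/
def ZPeriodic {α : Type*} (f : EuclideanSpace ℝ (Fin d) → α) : Prop :=
  ∀ (x : EuclideanSpace ℝ (Fin d)) (k : Fin d → ℤ),
    f (x + (WithLp.equiv 2 (Fin d → ℝ)).symm (fun i => (k i : ℝ))) = f x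

/-- `i`-th standard basis vector. -/
def evec (d : ℕ) (i : Fin d) : EuclideanSpace ℝ (Fin d) := EuclideanSpace.single i 1

/-- Spatial gradient of a space-time function. -/
def spatialGrad (η : EuclideanSpace ℝ (Fin d) × ℝ → ℝ) (x : EuclideanSpace ℝ (Fin d))
    (t : ℝ) : EuclideanSpace ℝ (Fin d) :=
  gradient (fun y => η (y, t)) x

/-- Second spatial partial derivatives `∂_{ij} η`. -/
def spatialD2 (η : EuclideanSpace ℝ (Fin d) × ℝ → ℝ) (x : EuclideanSpace ℝ (Fin d))
    (t : ℝ) (i j : Fin d) : ℝ :=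
  fderiv ℝ (fun y => fderiv ℝ (fun z => η (z, t)) y (evec d j)) x (evec d i)

/-- Time derivative `∂_t η`. -/
def timeD (η : EuclideanSpace ℝ (Fin d) × ℝ → ℝ) (x : EuclideanSpace ℝ (Fin d))
    (t : ℝ) : ℝ :=
  deriv (fun s => η (x, s)) t

/-- Viscosity subsolution of the level-set mean curvature flow with obstacles `φ, ψ`. -/
def IsViscositySubsol (φ ψ : EuclideanSpace ℝ (Fin d) → ℝ)
    (u : EuclideanSpace ℝ (Fin d) → ℝ → ℝ) : Prop :=
  ContinuousOn (fun p : EuclideanSpace ℝ (Fin d) × ℝ => u p.1 p.2)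
    (Set.univ ×ˢ Set.Ici 0) ∧
  (∃ M : ℝ, ∀ x t, 0 ≤ t → |u x t| ≤ M) ∧
  (∀ t : ℝ, ZPeriodic (fun x => u x t)) ∧
  (∀ x t, 0 ≤ t → φ x ≤ u x t ∧ u x t ≤ ψ x) ∧
  ∀ (η : EuclideanSpace ℝ (Fin d) × ℝ → ℝ), ContDiff ℝ (⊤ : ℕ∞) η →
    ∀ (x₀ : EuclideanSpace ℝ (Fin d)) (t₀ : ℝ), 0 < t₀ →
      IsLocalMax (fun p : EuclideanSpace ℝ (Fin d) × ℝ => u p.1 p.2 - η p) (x₀, t₀) →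
      φ x₀ < u x₀ t₀ →
      ((spatialGrad η x₀ t₀ ≠ 0 →
          timeD η x₀ t₀ ≤
            ∑ i, ∑ j,
              ((if i = j then (1 : ℝ) else 0) -
                ⟪spatialGrad η x₀ t₀, evec d i⟫ * ⟪spatialGrad η x₀ t₀, evec d j⟫ /
                  ‖spatialGrad η x₀ t₀‖ ^ 2) * spatialD2 η x₀ t₀ i j) ∧
       (spatialGrad η x₀ t₀ = 0 →
          ∃ ζ : EuclideanSpace ℝ (Fin d), ‖ζ‖ ≤ 1 ∧
            timeD η x₀ t₀ ≤
              ∑ i, ∑ j,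
                ((if i = j then (1 : ℝ) else 0) - ⟪ζ, evec d i⟫ * ⟪ζ, evec d j⟫) *
                  spatialD2 η x₀ t₀ i j))

/-- Viscosity supersolution of the level-set mean curvature flow with obstacles `φ, ψ`. -/
def IsViscositySupersol (φ ψ : EuclideanSpace ℝ (Fin d) → ℝ)
    (u : EuclideanSpace ℝ (Fin d) → ℝ → ℝ) : Prop :=
  ContinuousOn (fun p : EuclideanSpace ℝ (Fin d) × ℝ => u p.1 p.2)
    (Set.univ ×ˢ Set.Ici 0) ∧
  (∃ M : ℝ, ∀ x t, 0 ≤ t → |u x t| ≤ M) ∧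
  (∀ t : ℝ, ZPeriodic (fun x => u x t)) ∧
  (∀ x t, 0 ≤ t → φ x ≤ u x t ∧ u x t ≤ ψ x) ∧
  ∀ (η : EuclideanSpace ℝ (Fin d) × ℝ → ℝ), ContDiff ℝ (⊤ : ℕ∞) η →
    ∀ (x₀ : EuclideanSpace ℝ (Fin d)) (t₀ : ℝ), 0 < t₀ →
      IsLocalMin (fun p : EuclideanSpace ℝ (Fin d) × ℝ => u p.1 p.2 - η p) (x₀, t₀) →
      u x₀ t₀ < ψ x₀ →
      ((spatialGrad η x₀ t₀ ≠ 0 →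
          timeD η x₀ t₀ ≥
            ∑ i, ∑ j,
              ((if i = j then (1 : ℝ) else 0) -
                ⟪spatialGrad η x₀ t₀, evec d i⟫ * ⟪spatialGrad η x₀ t₀, evec d j⟫ /
                  ‖spatialGrad η x₀ t₀‖ ^ 2) * spatialD2 η x₀ t₀ i j) ∧
       (spatialGrad η x₀ t₀ = 0 →
          ∃ ζ : EuclideanSpace ℝ (Fin d), ‖ζ‖ ≤ 1 ∧
            timeD η x₀ t₀ ≥
              ∑ i, ∑ j,
                ((if i = j then (1 : ℝ) else 0) - ⟪ζ, evec d i⟫ * ⟪ζ, evec d j⟫) *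
                  spatialD2 η x₀ t₀ i j))

/-- `p` selects, at every point, the slope of a paraboloid of opening `C` touching `f` from
below; the existence of such a `p` means that `f` is semiconvex. -/
def IsSemiconvexSlope {V : Type*} [NormedAddCommGroup V] [InnerProductSpace ℝ V]
    (C : ℝ) (f : V → ℝ) (p : V → V) : Prop :=
  ∀ x y, f x + ⟪p x, y - x⟫ - C * ‖y - x‖ ^ 2 ≤ f y

lemma abs_sub_le_of_forall_increment {φ : ℝ → ℝ} {a b : ℝ}
    (h : ∀ s ∈ Set.Icc (0 : ℝ) 1, ∀ s' ∈ Set.Icc (0 : ℝ) 1,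
      -a * |s' - s| - b * (s' - s) ^ 2 ≤ φ s' - φ s) :
    |φ 1 - φ 0| ≤ a := by
  have key : ∀ N : ℕ, 0 < N → |φ 1 - φ 0| ≤ a + b / N := by
    intro N hN
    have hN' : (0 : ℝ) < N := by exact_mod_cast hN
    have mem : ∀ i : ℕ, i ≤ N → (i : ℝ) / N ∈ Set.Icc (0 : ℝ) 1 := fun i hi =>
      ⟨by positivity, by rw [div_le_one hN']; exact_mod_cast hi⟩
    have step : ∀ i : ℕ, i ≤ N → |φ (i / N) - φ 0| ≤ i * (a / N + b / N ^ 2) := by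
      intro i
      induction i with
      | zero => intro _; simp
      | succ i ih =>
        intro hi
        have ih := ih (by omega)
        have h1 := h _ (mem i (by omega)) _ (mem (i + 1) hi)
        have h2 := h _ (mem (i + 1) hi) _ (mem i (by omega))
        have e : ((i + 1 : ℕ) : ℝ) / N - i / N = 1 / N := by push_cast; ring
        have e' : (i : ℝ) / N - ((i + 1 : ℕ) : ℝ) / N = -(1 / N) := by push_cast; ring
        rw [e, abs_of_pos (by positivity)] at h1
        rw [e', abs_neg, abs_of_pos (by positivity)] at h2
        have e1 : a / N + b / N ^ 2 = a * (1 / N) + b * (1 / N) ^ 2 := by ring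
        rw [neg_sq] at h2
        have h1' : -(a / N + b / N ^ 2) ≤ φ ((i + 1 : ℕ) / N) - φ (i / N) := by linarith
        have h2' : -(a / N + b / N ^ 2) ≤ φ (i / N) - φ ((i + 1 : ℕ) / N) := by linarith
        generalize a / (N : ℝ) + b / N ^ 2 = K at *
        rw [abs_le] at ih ⊢
        have e2 : ((i + 1 : ℕ) : ℝ) * K = i * K + K := by push_cast; ring
        rw [e2]
        constructor <;> linarith [ih.1, ih.2]
    have := step N le_rfl
    rw [div_self hN'.ne'] at this
    convert this using 1
    field_simp
  have hlim : Tendsto (fun N : ℕ => a + b / (N : ℝ)) atTop (𝓝 (a + 0)) :=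
    tendsto_const_nhds.add (tendsto_const_div_atTop_nhds_zero_nat b)
  rw [add_zero] at hlim
  exact ge_of_tendsto hlim (eventually_atTop.2 ⟨1, fun N hN => key N hN⟩)

section Semiconvex

variable {V : Type*} [NormedAddCommGroup V] [InnerProductSpace ℝ V]

lemma norm_le_of_forall_inner_le {v : V} {A ρ : ℝ} (hρ : 0 < ρ)
    (h : ∀ e : V, ‖e‖ = ρ → ⟪v, e⟫ ≤ A * ρ) : ‖v‖ ≤ A ∨ v = 0 := by
  by_cases hv : v = 0
  · exact Or.inr hv
  left
  have hv' : 0 < ‖v‖ := norm_pos_iff.2 hv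
  have := h ((ρ / ‖v‖) • v) (by
    rw [norm_smul, Real.norm_of_nonneg (by positivity)]; field_simp)
  rw [real_inner_smul_right, real_inner_self_eq_norm_sq] at this
  have e : ρ / ‖v‖ * ‖v‖ ^ 2 = ‖v‖ * ρ := by field_simp
  rw [e] at this
  exact le_of_mul_le_mul_right this hρ

lemma IsSemiconvexSlope.eq_and_norm_sub_le {C C' : ℝ} {f : V → ℝ} {p : V → V} {x₀ p₀ : V}
    (hp : IsSemiconvexSlope C f p) (hC : 0 ≤ C) (hC' : 0 ≤ C')
    (h : ∀ y, f y ≤ f x₀ + ⟪p₀, y - x₀⟫ + C' * ‖y - x₀‖ ^ 2) :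
    p x₀ = p₀ ∧ ∀ x, ‖p x - p x₀‖ ≤ 4 * (C + C') * ‖x - x₀‖ := by
  have h0 : p x₀ = p₀ := by
    rw [← sub_eq_zero]
    by_contra hne
    have : ∀ ρ : ℝ, 0 < ρ → ‖p x₀ - p₀‖ ≤ (C + C') * ρ := by
      intro ρ hρ
      refine (norm_le_of_forall_inner_le hρ ?_).resolve_right hne
      intro e he
      have h1 := h (x₀ + e)
      have h2 := hp x₀ (x₀ + e)
      simp only [add_sub_cancel_left] at h1 h2
      rw [he] at h1 h2
      rw [inner_sub_left]
      nlinarith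
    have hpos := norm_pos_iff.2 hne
    have := this (‖p x₀ - p₀‖ / (2 * (C + C' + 1))) (by positivity)
    rw [← mul_div_assoc, le_div_iff₀ (by positivity)] at this
    nlinarith
  refine ⟨h0, fun x => ?_⟩
  by_cases hx : x = x₀
  · simp [hx]
  have hρ : 0 < ‖x - x₀‖ := norm_pos_iff.2 (sub_ne_zero.2 hx)
  suffices h1 : ∀ e : V, ‖e‖ = ‖x - x₀‖ → ⟪p x - p x₀, e⟫ ≤ 4 * (C + C') * ‖x - x₀‖ * ‖x - x₀‖ by
    rcases norm_le_of_forall_inner_le hρ h1 with h1 | h1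
    · exact h1
    · rw [h1, norm_zero]; positivity
  intro e he
  have h1 := h (x + e)
  have h2 := hp x (x + e)
  have h3 := hp x₀ x
  rw [add_sub_cancel_left, he] at h2
  have e1 : x + e - x₀ = (x - x₀) + e := by abel
  have h4 : ‖(x - x₀) + e‖ ≤ 2 * ‖x - x₀‖ := by
    have := norm_add_le (x - x₀) e
    linarith
  have h5 : ‖(x - x₀) + e‖ ^ 2 ≤ (2 * ‖x - x₀‖) ^ 2 := by gcongr
  rw [e1, inner_add_right, ← h0] at h1
  rw [inner_sub_left]
  nlinarith [mul_le_mul_of_nonneg_left h5 hC', mul_nonneg hC (sq_nonneg ‖x - x₀‖)]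

lemma IsSemiconvexSlope.convexOn {C : ℝ} {f : V → ℝ} {p : V → V}
    (hp : IsSemiconvexSlope C f p) : ConvexOn ℝ Set.univ (fun x => f x + C * ‖x‖ ^ 2) := by
  have hsub : ∀ x y, f x + C * ‖x‖ ^ 2 + ⟪p x + (2 * C) • x, y - x⟫ ≤ f y + C * ‖y‖ ^ 2 := by
    intro x y
    have h := hp x y
    have e : ‖y‖ ^ 2 = ‖x‖ ^ 2 + 2 * ⟪x, y - x⟫ + ‖y - x‖ ^ 2 := by
      rw [← norm_add_sq_real]; congr 2; abel
    rw [inner_add_left, real_inner_smul_left, e]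
    nlinarith
  refine ⟨convex_univ, fun x _ y _ a b ha hb hab => ?_⟩
  have h1 := hsub (a • x + b • y) x
  have h2 := hsub (a • x + b • y) y
  have e : a * ⟪p (a • x + b • y) + (2 * C) • (a • x + b • y), x - (a • x + b • y)⟫
      + b * ⟪p (a • x + b • y) + (2 * C) • (a • x + b • y), y - (a • x + b • y)⟫ = 0 := by
    rw [← real_inner_smul_right, ← real_inner_smul_right, ← inner_add_right]
    have : a • (x - (a • x + b • y)) + b • (y - (a • x + b • y)) = 0 := by
      have hb' : b = 1 - a := by linarith
      subst hb'; module
    rw [this, inner_zero_right]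
  simp only [smul_eq_mul]
  have h1' := mul_le_mul_of_nonneg_left h1 ha
  have h2' := mul_le_mul_of_nonneg_left h2 hb
  have e3 : ∀ Y : ℝ, Y = a * Y + b * Y := fun Y => by rw [← add_mul, hab, one_mul]
  rw [e3 (f (a • x + b • y) + C * ‖a • x + b • y‖ ^ 2)]
  linarith

lemma IsSemiconvexSlope.continuous [FiniteDimensional ℝ V] {C : ℝ} {f : V → ℝ} {p : V → V}
    (hp : IsSemiconvexSlope C f p) : Continuous f := by
  have h := hp.convexOn.continuousOn isOpen_univ
  rw [continuousOn_univ] at h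
  have h2 : Continuous fun x : V => (f x + C * ‖x‖ ^ 2) - C * ‖x‖ ^ 2 := by fun_prop
  simpa using h2

/-- A differentiable selection of slopes yields a second-order Taylor expansion. -/
lemma IsSemiconvexSlope.abs_taylor_le {C : ℝ} {f : V → ℝ} {p : V → V} {x₀ : V} {D : V →L[ℝ] V}
    (hp : IsSemiconvexSlope C f p) (hD : HasFDerivAt p D x₀) {σ : ℝ} (hσ : 0 < σ) :
    ∀ᶠ e in 𝓝 (0 : V), |f (x₀ + e) - f x₀ - ⟪p x₀, e⟫ - 1 / 2 * ⟪D e, e⟫| ≤ σ * ‖e‖ ^ 2 := by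
  have h0 := (hasFDerivAt_iff_isLittleO_nhds_zero.1 hD).def hσ
  obtain ⟨r, hr, hball⟩ := Metric.eventually_nhds_iff_ball.1 h0
  refine Metric.eventually_nhds_iff_ball.2 ⟨r, hr, fun e he => ?_⟩
  have hslope : ∀ s ∈ Set.Icc (0 : ℝ) 1,
      |⟪p (x₀ + s • e), e⟫ - ⟪p x₀, e⟫ - s * ⟪D e, e⟫| ≤ σ * ‖e‖ ^ 2 := by
    intro s hs
    have hs' : ‖s • e‖ ≤ ‖e‖ := by
      rw [norm_smul, Real.norm_of_nonneg hs.1]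
      exact mul_le_of_le_one_left (norm_nonneg _) hs.2
    have h1 := hball (s • e) (by
      rw [mem_ball_zero_iff] at he ⊢; exact hs'.trans_lt he)
    have e1 : ⟪p (x₀ + s • e), e⟫ - ⟪p x₀, e⟫ - s * ⟪D e, e⟫
        = ⟪p (x₀ + s • e) - p x₀ - D (s • e), e⟫ := by
      rw [inner_sub_left, inner_sub_left, map_smul, real_inner_smul_left]
    rw [e1]
    calc _ ≤ ‖p (x₀ + s • e) - p x₀ - D (s • e)‖ * ‖e‖ := abs_real_inner_le_norm _ _
      _ ≤ (σ * ‖e‖) * ‖e‖ := by gcongr; exact h1.trans (by gcongr)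
      _ = _ := by ring
  have := abs_sub_le_of_forall_increment (a := σ * ‖e‖ ^ 2)
    (b := C * ‖e‖ ^ 2 + 1 / 2 * ⟪D e, e⟫)
    (φ := fun s => f (x₀ + s • e) - s * ⟪p x₀, e⟫ - 1 / 2 * s ^ 2 * ⟪D e, e⟫) ?_
  · convert this using 2
    simp; ring
  intro s hs s' _
  have h1 := hp (x₀ + s • e) (x₀ + s' • e)
  have e1 : x₀ + s' • e - (x₀ + s • e) = (s' - s) • e := by module
  rw [e1, real_inner_smul_right, norm_smul, mul_pow, Real.norm_eq_abs, sq_abs] at h1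
  have h2 := hslope s hs
  have h3 : -(σ * ‖e‖ ^ 2) * |s' - s| ≤
      (s' - s) * (⟪p (x₀ + s • e), e⟫ - ⟪p x₀, e⟫ - s * ⟪D e, e⟫) := by
    have := neg_abs_le ((s' - s) * (⟪p (x₀ + s • e), e⟫ - ⟪p x₀, e⟫ - s * ⟪D e, e⟫))
    rw [abs_mul] at this
    nlinarith [mul_le_mul_of_nonneg_left h2 (abs_nonneg (s' - s))]
  nlinarith

end Semiconvex

section Jensen

variable {V : Type*} [NormedAddCommGroup V] [InnerProductSpace ℝ V] [FiniteDimensional ℝ V]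

/-- The derivative of a left inverse at a point where the inverted map is calm is invertible. -/
lemma exists_hasFDerivAt_of_leftInverse {P E : V → V} {x₀ : V} {A : V →L[ℝ] V} {K : ℝ}
    (hPE : ∀ x, P (E x) = x) (hA : HasFDerivAt P A (E x₀))
    (hK : ∀ x, ‖E x - E x₀‖ ≤ K * ‖x - x₀‖) : ∃ D : V →L[ℝ] V, HasFDerivAt E D x₀ := by
  have hcont : ContinuousAt E x₀ := by
    rw [ContinuousAt, tendsto_iff_norm_sub_tendsto_zero]
    refine squeeze_zero (fun _ => norm_nonneg _) hK ?_
    have : Continuous fun x : V => K * ‖x - x₀‖ := by fun_prop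
    simpa using this.tendsto x₀
  have hrange : A.range = ⊤ := by
    by_contra hne
    obtain ⟨ℓ, hℓ, hle⟩ := Submodule.exists_le_ker_of_lt_top _ (lt_top_iff_ne_top.2 hne)
    obtain ⟨e, he⟩ : ∃ e, ℓ e ≠ 0 := by
      by_contra! h
      exact hℓ (LinearMap.ext h)
    set ℓ' : V →L[ℝ] ℝ := LinearMap.toContinuousLinearMap ℓ with hℓ'
    have hℓA : ∀ v, ℓ' (A v) = 0 := fun v => hle ⟨v, rfl⟩
    have h1 : (fun x => P (E x) - P (E x₀) - A (E x - E x₀)) =o[𝓝 x₀] fun x => x - x₀ := by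
      refine ((hasFDerivAt_iff_isLittleO.1 hA).comp_tendsto hcont).trans_isBigO ?_
      exact Asymptotics.IsBigO.of_bound K (Eventually.of_forall hK)
    have h2 : (fun x => ℓ' (x - x₀)) =o[𝓝 x₀] fun x => x - x₀ := by
      refine ((ℓ'.isBigO_comp _ _).trans_isLittleO h1).congr_left fun x => ?_
      rw [hPE, hPE, map_sub, hℓA, sub_zero]
    have h3 : HasFDerivAt (fun x => ℓ' (x - x₀)) (0 : V →L[ℝ] ℝ) x₀ := by
      rw [hasFDerivAt_iff_isLittleO]
      simpa using h2
    have h4 : HasFDerivAt (fun x => ℓ' (x - x₀)) ℓ' x₀ :=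
      ℓ'.hasFDerivAt.comp x₀ ((hasFDerivAt_id x₀).sub_const x₀)
    have := congrArg (fun L : V →L[ℝ] ℝ => L e) (h3.unique h4)
    exact he this.symm
  have hker : A.ker = ⊥ := by
    rw [LinearMap.ker_eq_bot]
    exact LinearMap.injective_iff_surjective.2 (LinearMap.range_eq_top.1 hrange)
  refine ⟨_, HasFDerivAt.of_local_left_inverse (f := P)
    (f' := ContinuousLinearEquiv.ofBijective A hker hrange) hcont ?_ (Eventually.of_forall hPE)⟩
  exact hA

open Measure in
/-- Alexandrov's theorem for semiconvex functions, at points where the slope is calm. -/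
lemma IsSemiconvexSlope.exists_null_hasFDerivAt [MeasurableSpace V] [BorelSpace V]
    (μ : Measure V) (hμ : μ = μH[(Module.finrank ℝ V : ℝ)]) {C : ℝ} {f : V → ℝ} {p : V → V}
    (hp : IsSemiconvexSlope C f p) :
    ∃ N : Set V, μ N = 0 ∧ ∀ x₀ ∉ N, ∀ K : ℝ, (∀ x, ‖p x - p x₀‖ ≤ K * ‖x - x₀‖) →
      ∃ D : V →L[ℝ] V, HasFDerivAt p D x₀ := by
  have : μ.IsAddHaarMeasure := hμ ▸ isAddHaarMeasure_hausdorffMeasure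
  set E : V → V := fun x => p x + (1 + 2 * C) • x with hE
  have hanti : ∀ x y, ‖x - y‖ ≤ ‖E x - E y‖ := by
    intro x y
    have h1 := hp x y
    have h2 := hp y x
    rw [norm_sub_rev, ← neg_sub x y, inner_neg_right] at h1
    have h3 : ‖x - y‖ ^ 2 ≤ ⟪E x - E y, x - y⟫ := by
      have : E x - E y = p x - p y + (1 + 2 * C) • (x - y) := by simp only [hE]; module
      rw [this, inner_add_left, inner_sub_left, real_inner_smul_left, real_inner_self_eq_norm_sq]
      linarith
    have h4 := h3.trans (real_inner_le_norm _ _)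
    by_cases h0 : ‖x - y‖ = 0
    · rw [h0]; positivity
    · have h5 : 0 < ‖x - y‖ := lt_of_le_of_ne (norm_nonneg _) (Ne.symm h0)
      nlinarith
  have hinj : Function.Injective E := fun x y hxy => by
    have := hanti x y
    rw [hxy, sub_self, norm_zero] at this
    exact sub_eq_zero.1 (norm_le_zero_iff.1 this)
  have hlip : LipschitzOnWith 1 (Function.invFun E) (Set.range E) := by
    refine LipschitzOnWith.of_dist_le_mul ?_
    rintro _ ⟨x, rfl⟩ _ ⟨y, rfl⟩
    rw [Function.leftInverse_invFun hinj x, Function.leftInverse_invFun hinj y, dist_eq_norm,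
      dist_eq_norm, NNReal.coe_one, one_mul]
    exact hanti x y
  obtain ⟨P, hP, hPE⟩ := hlip.extend_finite_dimension
  have hPE' : ∀ x, P (E x) = x := fun x => by
    rw [← hPE ⟨x, rfl⟩, Function.leftInverse_invFun hinj x]
  refine ⟨P '' {y | ¬ DifferentiableAt ℝ P y}, ?_, ?_⟩
  · have h0 : μ {y | ¬ DifferentiableAt ℝ P y} = 0 := ae_iff.1 hP.ae_differentiableAt
    have := hP.lipschitzOnWith.hausdorffMeasure_image_le (s := {y | ¬ DifferentiableAt ℝ P y})
      (d := Module.finrank ℝ V) (by positivity)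
    rw [← hμ, h0, mul_zero] at this
    exact le_antisymm this bot_le
  · intro x₀ hx₀ K hK
    have hd : DifferentiableAt ℝ P (E x₀) := by
      by_contra hd
      exact hx₀ ⟨E x₀, hd, hPE' x₀⟩
    obtain ⟨D, hD⟩ := exists_hasFDerivAt_of_leftInverse (K := K + |1 + 2 * C|) hPE'
      hd.hasFDerivAt (fun x => by
        have : E x - E x₀ = (p x - p x₀) + (1 + 2 * C) • (x - x₀) := by simp only [hE]; module
        rw [this, add_mul]
        refine (norm_add_le _ _).trans (add_le_add (hK x) ?_)
        rw [norm_smul, Real.norm_eq_abs])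
    refine ⟨D - (1 + 2 * C) • ContinuousLinearMap.id ℝ V, ?_⟩
    have h2 := hD.sub ((hasFDerivAt_id x₀).const_smul (1 + 2 * C))
    refine h2.congr_of_eventuallyEq (Eventually.of_forall fun x => ?_)
    simp [hE]

/-- Jensen's lemma combined with Alexandrov's theorem: near a maximum point of the sum of two
semiconvex functions there are points at which both slopes are differentiable and which are
almost maximum points up to second order. -/
theorem IsSemiconvexSlope.exists_hasFDerivAt_near_max {C : ℝ} (hC : 0 ≤ C) {f g : V → ℝ}
    {p q : V → V} (hf : IsSemiconvexSlope C f p) (hg : IsSemiconvexSlope C g q) {x₀ : V}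
    (hmax : ∀ x, f x + g x ≤ f x₀ + g x₀) {c : ℝ} (hc : 0 < c) {r : ℝ} (hr : 0 < r) :
    ∃ (x ω : V) (D₁ D₂ : V →L[ℝ] V), ‖x - x₀‖ ≤ r ∧ ‖ω‖ ≤ r ∧ p x + q x = ω ∧
      HasFDerivAt p D₁ x ∧ HasFDerivAt q D₂ x ∧
      ∀ y, f y + g y ≤ f x + g x + ⟪ω, y - x⟫ + c * ‖y - x‖ ^ 2 := by
  borelize V
  set μ : Measure V := μH[(Module.finrank ℝ V : ℝ)] with hμ
  have hHaar : μ.IsAddHaarMeasure := MeasureTheory.isAddHaarMeasure_hausdorffMeasure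
  obtain ⟨N₁, hN₁, hN₁'⟩ := hf.exists_null_hasFDerivAt μ hμ
  obtain ⟨N₂, hN₂, hN₂'⟩ := hg.exists_null_hasFDerivAt μ hμ
  have hfc := hf.continuous
  have hgc := hg.continuous
  -- maximum points of the perturbed sum
  have hex : ∀ ω : V, ∃ x, ‖x - x₀‖ ≤ ‖ω‖ / c ∧ ∀ y,
      f y + g y - c * ‖y - x₀‖ ^ 2 - ⟪ω, y - x₀⟫ ≤ f x + g x - c * ‖x - x₀‖ ^ 2 - ⟪ω, x - x₀⟫ := by
    intro ω
    have hcont : Continuous fun y => f y + g y - c * ‖y - x₀‖ ^ 2 - ⟪ω, y - x₀⟫ := by fun_prop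
    obtain ⟨x, hx, hxmax⟩ := (isCompact_closedBall x₀ (‖ω‖ / c)).exists_isMaxOn
      ⟨x₀, Metric.mem_closedBall_self (by positivity)⟩ hcont.continuousOn
    refine ⟨x, by simpa [dist_eq_norm] using hx, fun y => ?_⟩
    by_cases hy : y ∈ Metric.closedBall x₀ (‖ω‖ / c)
    · exact hxmax hy
    · have h1 := hxmax (Metric.mem_closedBall_self (x := x₀) (by positivity : 0 ≤ ‖ω‖ / c))
      simp only [Set.mem_ofPred_eq, sub_self, norm_zero, inner_zero_right] at h1
      rw [Metric.mem_closedBall, dist_eq_norm, not_le, div_lt_iff₀ hc] at hy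
      have h2 := neg_le_of_abs_le (abs_real_inner_le_norm ω (y - x₀))
      have h3 := hmax y
      nlinarith [norm_nonneg (y - x₀)]
  choose X hX hXmax using hex
  set Ω : V → V := fun ω => ω + (2 * c) • (X ω - x₀) with hΩ
  have htouch : ∀ ω y, f y + g y ≤ f (X ω) + g (X ω) + ⟪Ω ω, y - X ω⟫ + c * ‖y - X ω‖ ^ 2 := by
    intro ω y
    have h1 := hXmax ω y
    have e1 : y - x₀ = (X ω - x₀) + (y - X ω) := by abel
    rw [e1, norm_add_sq_real, inner_add_right] at h1
    rw [hΩ, inner_add_left, real_inner_smul_left]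
    nlinarith
  have hp' : ∀ ω, p (X ω) = Ω ω - q (X ω) ∧
      ∀ x, ‖p x - p (X ω)‖ ≤ 4 * (C + (c + C)) * ‖x - X ω‖ := by
    intro ω
    have := hf.eq_and_norm_sub_le (x₀ := X ω) (p₀ := Ω ω - q (X ω)) (C' := c + C) hC
      (by positivity) (fun y => by
        have h1 := htouch ω y
        have h2 := hg (X ω) y
        rw [inner_sub_left]
        nlinarith)
    exact this
  have hq' : ∀ ω, ∀ x, ‖q x - q (X ω)‖ ≤ 4 * (C + (c + C)) * ‖x - X ω‖ := by
    intro ω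
    have := hg.eq_and_norm_sub_le (x₀ := X ω) (p₀ := Ω ω - p (X ω)) (C' := c + C) hC
      (by positivity) (fun y => by
        have h1 := htouch ω y
        have h2 := hf (X ω) y
        rw [inner_sub_left]
        nlinarith)
    exact this.2
  set δ : ℝ := min (c * r) (r / 3) with hδ
  have hδ0 : 0 < δ := by positivity
  obtain ⟨ω, hωδ, hωN⟩ : ∃ ω ∈ Metric.ball (0 : V) δ, X ω ∉ N₁ ∪ N₂ := by
    by_contra! hall
    set T : V → V := fun x => p x + q x - (2 * c) • (x - x₀) with hT
    have hTX : ∀ ω, T (X ω) = ω := by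
      intro ω
      simp only [hT, (hp' ω).1, hΩ]
      abel
    set S : Set V := X '' Metric.ball (0 : V) δ with hS
    have hlip : LipschitzOnWith (Real.toNNReal (8 * (C + (c + C)) + 2 * c)) T S := by
      refine LipschitzOnWith.of_dist_le_mul ?_
      rintro x - _ ⟨ω, hω, rfl⟩
      rw [Real.coe_toNNReal _ (by positivity), dist_eq_norm, dist_eq_norm]
      have : T x - T (X ω) = (p x - p (X ω)) + (q x - q (X ω)) - (2 * c) • (x - X ω) := by
        simp only [hT]; module
      rw [this]
      refine (norm_sub_le _ _).trans ?_
      have h1 := norm_add_le (p x - p (X ω)) (q x - q (X ω))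
      have h2 := (hp' ω).2 x
      have h3 := hq' ω x
      rw [norm_smul, Real.norm_of_nonneg (by positivity)]
      linarith
    have hSN : μ S = 0 := by
      refine measure_mono_null ?_ (measure_union_null hN₁ hN₂)
      rintro _ ⟨ω, hω, rfl⟩
      exact hall ω hω
    have h1 := hlip.hausdorffMeasure_image_le (d := Module.finrank ℝ V) (by positivity)
    rw [← hμ, hSN, mul_zero] at h1
    have h2 : Metric.ball (0 : V) δ ⊆ T '' S := fun ω hω => ⟨X ω, ⟨ω, hω, rfl⟩, hTX ω⟩
    have h3 : 0 < μ (Metric.ball (0 : V) δ) := Metric.measure_ball_pos μ 0 hδ0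
    exact absurd (h3.trans_le (measure_mono h2)) (not_lt.2 h1)
  rw [Set.mem_union, not_or] at hωN
  rw [mem_ball_zero_iff] at hωδ
  obtain ⟨D₁, hD₁⟩ := hN₁' _ hωN.1 _ (hp' ω).2
  obtain ⟨D₂, hD₂⟩ := hN₂' _ hωN.2 _ (hq' ω)
  have hω1 : ‖ω‖ < c * r := hωδ.trans_le (min_le_left _ _)
  have hω2 : ‖ω‖ < r / 3 := hωδ.trans_le (min_le_right _ _)
  have hXr : c * ‖X ω - x₀‖ ≤ ‖ω‖ := by
    have := hX ω
    rw [le_div_iff₀ hc] at this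
    linarith
  refine ⟨X ω, Ω ω, D₁, D₂, ?_, ?_, ?_, hD₁, hD₂, htouch ω⟩
  · nlinarith
  · refine (norm_add_le _ _).trans ?_
    rw [norm_smul, Real.norm_of_nonneg (by positivity)]
    linarith
  · rw [(hp' ω).1, sub_add_cancel]

end Jensen

section Hessian

variable {V : Type*} [NormedAddCommGroup V] [InnerProductSpace ℝ V]

/-- A quadratic bound near the origin with arbitrarily small error holds everywhere. -/
lemma le_of_eventually_quadratic_le {D : V →L[ℝ] V} {m : ℝ}
    (h : ∀ σ > 0, ∀ᶠ e in 𝓝 (0 : V), ⟪D e, e⟫ ≤ m * ‖e‖ ^ 2 + σ * ‖e‖ ^ 2) (e : V) :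
    ⟪D e, e⟫ ≤ m * ‖e‖ ^ 2 := by
  have key : ∀ σ > 0, ⟪D e, e⟫ ≤ m * ‖e‖ ^ 2 + σ * ‖e‖ ^ 2 := by
    intro σ hσ
    have ht : Tendsto (fun s : ℝ => s • e) (𝓝[>] 0) (𝓝 (0 : V)) := by
      have : Continuous fun s : ℝ => s • e := by fun_prop
      have := this.tendsto 0
      rw [zero_smul] at this
      exact this.mono_left nhdsWithin_le_nhds
    obtain ⟨s, hs, hs0⟩ := ((ht.eventually (h σ hσ)).and self_mem_nhdsWithin).exists
    have hs0 : 0 < s := hs0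
    rw [map_smul, real_inner_smul_left, real_inner_smul_right, norm_smul,
      Real.norm_of_nonneg hs0.le] at hs
    have : s ^ 2 * ⟪D e, e⟫ ≤ s ^ 2 * (m * ‖e‖ ^ 2 + σ * ‖e‖ ^ 2) := by nlinarith
    exact le_of_mul_le_mul_left this (by positivity)
  have hlim : Tendsto (fun σ : ℝ => m * ‖e‖ ^ 2 + σ * ‖e‖ ^ 2) (𝓝[>] 0)
      (𝓝 (m * ‖e‖ ^ 2 + 0 * ‖e‖ ^ 2)) := by
    have : Continuous fun σ : ℝ => m * ‖e‖ ^ 2 + σ * ‖e‖ ^ 2 := by fun_prop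
    exact (this.tendsto 0).mono_left nhdsWithin_le_nhds
  rw [zero_mul, add_zero] at hlim
  exact ge_of_tendsto hlim (eventually_nhdsWithin_of_forall key)

lemma IsSemiconvexSlope.neg_le_inner_fderiv {C : ℝ} {f : V → ℝ} {p : V → V} {x₀ : V}
    {D : V →L[ℝ] V} (hp : IsSemiconvexSlope C f p) (hD : HasFDerivAt p D x₀) (e : V) :
    -(2 * C) * ‖e‖ ^ 2 ≤ ⟪D e, e⟫ := by
  have := le_of_eventually_quadratic_le (D := -D) (m := 2 * C) (fun σ hσ => by
    filter_upwards [hp.abs_taylor_le hD (half_pos hσ)] with e he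
    have h1 := hp x₀ (x₀ + e)
    rw [add_sub_cancel_left] at h1
    have h2 := (abs_le.1 he).2
    rw [neg_apply, inner_neg_left]
    nlinarith) e
  rw [neg_apply, inner_neg_left] at this
  linarith

lemma IsSemiconvexSlope.inner_fderiv_add_le {C c : ℝ} {f g : V → ℝ} {p q : V → V} {x₀ ω : V}
    {D₁ D₂ : V →L[ℝ] V} (hf : IsSemiconvexSlope C f p) (hg : IsSemiconvexSlope C g q)
    (hD₁ : HasFDerivAt p D₁ x₀) (hD₂ : HasFDerivAt q D₂ x₀) (hω : p x₀ + q x₀ = ω)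
    (h : ∀ y, f y + g y ≤ f x₀ + g x₀ + ⟪ω, y - x₀⟫ + c * ‖y - x₀‖ ^ 2) (e : V) :
    ⟪D₁ e, e⟫ + ⟪D₂ e, e⟫ ≤ 2 * c * ‖e‖ ^ 2 := by
  have := le_of_eventually_quadratic_le (D := D₁ + D₂) (m := 2 * c) (fun σ hσ => by
    filter_upwards [hf.abs_taylor_le hD₁ (by positivity : 0 < σ / 4),
      hg.abs_taylor_le hD₂ (by positivity : 0 < σ / 4)] with e h1 h2
    have h3 := h (x₀ + e)
    rw [add_sub_cancel_left, ← hω, inner_add_left] at h3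
    have h1 := (abs_le.1 h1).1
    have h2 := (abs_le.1 h2).1
    rw [add_apply, inner_add_left]
    nlinarith) e
  rwa [add_apply, inner_add_left] at this

end Hessian

section Superjet

/-- Space-time with its Euclidean structure. -/
abbrev SpaceTime (d : ℕ) : Type := WithLp 2 (EuclideanSpace ℝ (Fin d) × ℝ)

/-- The inclusion of space into space-time. -/
def spaceIncl (d : ℕ) : EuclideanSpace ℝ (Fin d) →L[ℝ] SpaceTime d :=
  (WithLp.prodContinuousLinearEquiv 2 ℝ (EuclideanSpace ℝ (Fin d)) ℝ).symm.toContinuousLinearMap.comp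
    (ContinuousLinearMap.inl ℝ (EuclideanSpace ℝ (Fin d)) ℝ)

/-- The unit vector in the time direction. -/
def timeVec (d : ℕ) : SpaceTime d := WithLp.toLp 2 (0, 1)

@[simp] lemma spaceIncl_fst (x : EuclideanSpace ℝ (Fin d)) : (spaceIncl d x).fst = x := rfl

@[simp] lemma spaceIncl_snd (x : EuclideanSpace ℝ (Fin d)) : (spaceIncl d x).snd = 0 := rfl

@[simp] lemma timeVec_fst : (timeVec d).fst = 0 := rfl

@[simp] lemma timeVec_snd : (timeVec d).snd = 1 := rfl

lemma SpaceTime.inner_eq (X Y : SpaceTime d) :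
    ⟪X, Y⟫ = ⟪X.fst, Y.fst⟫ + X.snd * Y.snd := by
  rw [WithLp.prod_inner_apply, mul_comm]
  rfl

lemma SpaceTime.norm_sq_eq (X : SpaceTime d) : ‖X‖ ^ 2 = ‖X.fst‖ ^ 2 + X.snd ^ 2 := by
  rw [WithLp.prod_norm_sq_eq_of_L2, Real.norm_eq_abs, sq_abs]

lemma norm_spaceIncl (x : EuclideanSpace ℝ (Fin d)) : ‖spaceIncl d x‖ = ‖x‖ := by
  rw [← sq_eq_sq₀ (norm_nonneg _) (norm_nonneg _), SpaceTime.norm_sq_eq]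
  simp

lemma sum_inner_evec_smul (x : EuclideanSpace ℝ (Fin d)) :
    ∑ i, ⟪x, evec d i⟫ • evec d i = x := by
  have := (EuclideanSpace.basisFun (Fin d) ℝ).sum_repr' x
  simp only [EuclideanSpace.basisFun_apply] at this
  conv_rhs => rw [← this]
  exact Finset.sum_congr rfl fun i _ => by rw [real_inner_comm]; rfl

/-- The trace of the spatial block of an operator on space-time. -/
def spatialTrace (D : SpaceTime d →L[ℝ] SpaceTime d) : ℝ :=
  ∑ i, ⟪D (spaceIncl d (evec d i)), spaceIncl d (evec d i)⟫

lemma sum_projection_mul_hessian (D : SpaceTime d →L[ℝ] SpaceTime d)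
    (a : EuclideanSpace ℝ (Fin d)) (c : ℝ) :
    ∑ i, ∑ j, ((if i = j then (1 : ℝ) else 0) - ⟪a, evec d i⟫ * ⟪a, evec d j⟫ / c) *
      (1 / 2 * (⟪D (spaceIncl d (evec d j)), spaceIncl d (evec d i)⟫ +
        ⟪D (spaceIncl d (evec d i)), spaceIncl d (evec d j)⟫)) =
      spatialTrace D - ⟪D (spaceIncl d a), spaceIncl d a⟫ / c := by
  have h1 : ⟪D (spaceIncl d a), spaceIncl d a⟫ = ∑ i, ∑ j, ⟪a, evec d i⟫ * ⟪a, evec d j⟫ *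
      ⟪D (spaceIncl d (evec d i)), spaceIncl d (evec d j)⟫ := by
    conv_lhs => rw [← sum_inner_evec_smul a]
    simp only [map_sum, map_smul, sum_inner, inner_sum, real_inner_smul_left,
      real_inner_smul_right]
    rw [Finset.sum_comm]
    refine Finset.sum_congr rfl fun i _ => Finset.sum_congr rfl fun j _ => by ring
  have h2 : ⟪D (spaceIncl d a), spaceIncl d a⟫ = ∑ i, ∑ j, ⟪a, evec d i⟫ * ⟪a, evec d j⟫ *
      ⟪D (spaceIncl d (evec d j)), spaceIncl d (evec d i)⟫ := by
    rw [Finset.sum_comm]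
    refine h1.trans (Finset.sum_congr rfl fun i _ => Finset.sum_congr rfl fun j _ => by ring)
  have h3 : spatialTrace D = ∑ i, ∑ j, (if i = j then (1 : ℝ) else 0) *
      (1 / 2 * (⟪D (spaceIncl d (evec d j)), spaceIncl d (evec d i)⟫ +
        ⟪D (spaceIncl d (evec d i)), spaceIncl d (evec d j)⟫)) := by
    simp only [ite_mul, one_mul, zero_mul, Finset.sum_ite_eq, Finset.mem_univ, if_true]
    refine Finset.sum_congr rfl fun i _ => by ring
  have h4 : ⟪D (spaceIncl d a), spaceIncl d a⟫ = ∑ i, ∑ j, ⟪a, evec d i⟫ * ⟪a, evec d j⟫ *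
      (1 / 2 * (⟪D (spaceIncl d (evec d j)), spaceIncl d (evec d i)⟫ +
        ⟪D (spaceIncl d (evec d i)), spaceIncl d (evec d j)⟫)) := by
    have h : ⟪D (spaceIncl d a), spaceIncl d a⟫ = 1 / 2 * ⟪D (spaceIncl d a), spaceIncl d a⟫ +
        1 / 2 * ⟪D (spaceIncl d a), spaceIncl d a⟫ := by ring
    refine h.trans ((congrArg₂ (fun y z => 1 / 2 * y + 1 / 2 * z) h2 h1).trans ?_)
    simp only [Finset.mul_sum, ← Finset.sum_add_distrib]
    refine Finset.sum_congr rfl fun i _ => Finset.sum_congr rfl fun j _ => by ring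
  rw [h3, h4]
  simp only [Finset.sum_div, ← Finset.sum_sub_distrib]
  refine Finset.sum_congr rfl fun i _ => Finset.sum_congr rfl fun j _ => by ring

/-- The quadratic polynomial on space-time with given slope and Hessian at a given point. -/
def quadPoly (Z P : SpaceTime d) (D : SpaceTime d →L[ℝ] SpaceTime d)
    (z : EuclideanSpace ℝ (Fin d) × ℝ) : ℝ :=
  ⟪P, WithLp.toLp 2 z - Z⟫ + 1 / 2 * ⟪D (WithLp.toLp 2 z - Z), WithLp.toLp 2 z - Z⟫

variable (Z P : SpaceTime d) (D : SpaceTime d →L[ℝ] SpaceTime d)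

lemma contDiff_quadPoly {n : WithTop ℕ∞} : ContDiff ℝ n (quadPoly Z P D) := by
  have h : ContDiff ℝ n fun z : EuclideanSpace ℝ (Fin d) × ℝ => WithLp.toLp 2 z - Z :=
    (WithLp.prodContinuousLinearEquiv 2 ℝ (EuclideanSpace ℝ (Fin d)) ℝ).symm.contDiff.sub
      contDiff_const
  exact (contDiff_const.inner ℝ h).add (contDiff_const.mul ((D.contDiff.comp h).inner ℝ h))

lemma quadPoly_space (y : EuclideanSpace ℝ (Fin d)) :
    quadPoly Z P D (y, Z.snd) = ⟪P, spaceIncl d (y - Z.fst)⟫ +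
      1 / 2 * ⟪D (spaceIncl d (y - Z.fst)), spaceIncl d (y - Z.fst)⟫ := by
  have : WithLp.toLp 2 (y, Z.snd) - Z = spaceIncl d (y - Z.fst) := by
    apply WithLp.ofLp_injective
    ext1
    · rfl
    · exact sub_self _
  rw [quadPoly, this]

lemma quadPoly_time (s : ℝ) :
    quadPoly Z P D (Z.fst, s) = (s - Z.snd) * P.snd +
      (s - Z.snd) ^ 2 * (1 / 2 * ⟪D (timeVec d), timeVec d⟫) := by
  have : WithLp.toLp 2 (Z.fst, s) - Z = (s - Z.snd) • timeVec d := by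
    apply WithLp.ofLp_injective
    ext1
    · exact (sub_self _).trans (smul_zero _).symm
    · exact (mul_one _).symm
  rw [quadPoly, this, map_smul, real_inner_smul_left, real_inner_smul_right,
    real_inner_smul_right, SpaceTime.inner_eq P]
  simp
  ring

lemma hasFDerivAt_quadPoly_space (y : EuclideanSpace ℝ (Fin d)) :
    HasFDerivAt (fun z => quadPoly Z P D (z, Z.snd))
      ((innerSL ℝ P + (1 / 2 : ℝ) • (innerSL ℝ (D (spaceIncl d (y - Z.fst))) +
        (innerSL ℝ (spaceIncl d (y - Z.fst))).comp D)).comp (spaceIncl d)) y := by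
  simp only [quadPoly_space]
  have h1 : HasFDerivAt (fun z => spaceIncl d (z - Z.fst)) (spaceIncl d) y :=
    (spaceIncl d).hasFDerivAt.comp y ((hasFDerivAt_id y).sub_const Z.fst)
  have h2 := ((hasFDerivAt_const P y).inner ℝ h1).add
    ((((D.hasFDerivAt.comp y h1).inner ℝ h1)).const_mul (1 / 2 : ℝ))
  refine h2.congr_fderiv ?_
  ext e
  simp [fderivInnerCLM_apply, real_inner_comm, inner_sub_left, inner_sub_right]
  ring

lemma spatialGrad_quadPoly : spatialGrad (quadPoly Z P D) Z.fst Z.snd = P.fst := by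
  refine HasGradientAt.gradient ?_
  rw [hasGradientAt_iff_hasFDerivAt]
  refine (hasFDerivAt_quadPoly_space Z P D Z.fst).congr_fderiv ?_
  ext e
  simp

lemma spatialD2_quadPoly (i j : Fin d) : spatialD2 (quadPoly Z P D) Z.fst Z.snd i j =
    1 / 2 * (⟪D (spaceIncl d (evec d j)), spaceIncl d (evec d i)⟫ +
        ⟪D (spaceIncl d (evec d i)), spaceIncl d (evec d j)⟫) := by
  have h0 : (fun y => fderiv ℝ (fun z => quadPoly Z P D (z, Z.snd)) y (evec d j)) =
      fun y => ⟪P, spaceIncl d (evec d j)⟫ + 1 / 2 *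
        (⟪D (spaceIncl d (y - Z.fst)), spaceIncl d (evec d j)⟫ +
          ⟪spaceIncl d (y - Z.fst), D (spaceIncl d (evec d j))⟫) := by
    funext y
    rw [(hasFDerivAt_quadPoly_space Z P D y).fderiv]
    simp [inner_sub_left]
    ring
  have h1 : HasFDerivAt (fun z => spaceIncl d (z - Z.fst)) (spaceIncl d) Z.fst :=
    (spaceIncl d).hasFDerivAt.comp Z.fst ((hasFDerivAt_id Z.fst).sub_const Z.fst)
  have h2 := ((((D.hasFDerivAt.comp Z.fst h1).inner ℝ (hasFDerivAt_const
      (spaceIncl d (evec d j)) Z.fst)).add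
    (h1.inner ℝ (hasFDerivAt_const (D (spaceIncl d (evec d j))) Z.fst))).const_mul
      (1 / 2 : ℝ)).const_add (⟪P, spaceIncl d (evec d j)⟫)
  have h3 := h2.fderiv
  simp only [Function.comp_apply] at h3
  rw [spatialD2, h0]
  refine (congrArg (fun L : EuclideanSpace ℝ (Fin d) →L[ℝ] ℝ => L (evec d i)) h3).trans ?_
  simp [fderivInnerCLM_apply, real_inner_comm]
  ring

lemma timeD_quadPoly : timeD (quadPoly Z P D) Z.fst Z.snd = P.snd := by
  rw [timeD]
  simp only [quadPoly_time]
  have h1 : HasDerivAt (fun s : ℝ => s - Z.snd) 1 Z.snd := (hasDerivAt_id Z.snd).sub_const _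
  have h2 := (h1.mul_const P.snd).add ((h1.pow 2).mul_const (1 / 2 * ⟪D (timeVec d), timeVec d⟫))
  have h3 := h2.deriv
  simp only [sub_self] at h3
  refine Eq.trans ?_ (h3.trans (by simp))
  rfl

variable {Z P D}

/-- The viscosity inequality at a point where a quadratic polynomial touches from above. -/
lemma IsViscositySubsol.superjet {φ ψ : EuclideanSpace ℝ (Fin d) → ℝ}
    {u : EuclideanSpace ℝ (Fin d) → ℝ → ℝ} (hu : IsViscositySubsol φ ψ u) (ht : 0 < Z.snd)
    (hφ : φ Z.fst < u Z.fst Z.snd)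
    (h : ∀ᶠ e in 𝓝 (0 : SpaceTime d), u (Z + e).fst (Z + e).snd ≤
      u Z.fst Z.snd + ⟪P, e⟫ + 1 / 2 * ⟪D e, e⟫) :
    ∃ ζ : EuclideanSpace ℝ (Fin d), ‖ζ‖ ≤ 1 ∧ (P.fst ≠ 0 → ζ = ‖P.fst‖⁻¹ • P.fst) ∧
      P.snd ≤ spatialTrace D - ⟪D (spaceIncl d ζ), spaceIncl d ζ⟫ := by
  have hloc : IsLocalMax (fun p : EuclideanSpace ℝ (Fin d) × ℝ => u p.1 p.2 - quadPoly Z P D p)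
      (Z.fst, Z.snd) := by
    have hcont : Tendsto (fun p : EuclideanSpace ℝ (Fin d) × ℝ => WithLp.toLp 2 p - Z)
        (𝓝 (Z.fst, Z.snd)) (𝓝 0) := by
      have h1 : Continuous fun p : EuclideanSpace ℝ (Fin d) × ℝ => WithLp.toLp 2 p - Z :=
        (WithLp.prodContinuousLinearEquiv 2 ℝ (EuclideanSpace ℝ (Fin d)) ℝ).symm.continuous.sub
          continuous_const
      have h2 := h1.tendsto (Z.fst, Z.snd)
      have h3 : WithLp.toLp 2 (Z.fst, Z.snd) - Z = 0 := sub_self Z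
      rwa [h3] at h2
    filter_upwards [hcont.eventually h] with p hp
    have h0 : quadPoly Z P D (Z.fst, Z.snd) = 0 := by
      rw [quadPoly_space]; simp
    rw [add_sub_cancel] at hp
    have hp' : u p.1 p.2 ≤ u Z.fst Z.snd + ⟪P, WithLp.toLp 2 p - Z⟫ +
      1 / 2 * ⟪D (WithLp.toLp 2 p - Z), WithLp.toLp 2 p - Z⟫ := hp
    change u p.1 p.2 - quadPoly Z P D p ≤ u Z.fst Z.snd - quadPoly Z P D (Z.fst, Z.snd)
    rw [h0, quadPoly]
    linarith
  have := hu.2.2.2.2 (quadPoly Z P D) (contDiff_quadPoly Z P D) Z.fst Z.snd ht hloc hφ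
  simp only [spatialGrad_quadPoly, timeD_quadPoly, spatialD2_quadPoly] at this
  by_cases hP : P.fst = 0
  · obtain ⟨ζ, hζ, h1⟩ := this.2 hP
    refine ⟨ζ, hζ, fun h => absurd hP h, h1.trans_eq ?_⟩
    have := sum_projection_mul_hessian D ζ 1
    simpa only [div_one] using this
  · refine ⟨‖P.fst‖⁻¹ • P.fst, ?_, fun _ => rfl, (this.1 hP).trans_eq ?_⟩
    · rw [norm_smul, norm_inv, norm_norm, inv_mul_cancel₀ (norm_ne_zero_iff.2 hP)]
    · rw [sum_projection_mul_hessian]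
      simp only [map_smul, real_inner_smul_left, real_inner_smul_right]
      congr 1
      ring

lemma IsViscositySupersol.neg {φ ψ : EuclideanSpace ℝ (Fin d) → ℝ}
    {v : EuclideanSpace ℝ (Fin d) → ℝ → ℝ} (hv : IsViscositySupersol φ ψ v) :
    IsViscositySubsol (fun x => -ψ x) (fun x => -φ x) (fun x t => -v x t) := by
  obtain ⟨hc, ⟨M, hM⟩, hp, hb, hvisc⟩ := hv
  refine ⟨hc.neg, ⟨M, fun x t ht => by rw [abs_neg]; exact hM x t ht⟩,
    fun t x k => congrArg Neg.neg (hp t x k),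
    fun x t ht => ⟨neg_le_neg (hb x t ht).2, neg_le_neg (hb x t ht).1⟩, ?_⟩
  intro η hη x₀ t₀ ht₀ hmax hlt
  have hg : spatialGrad (fun z => -η z) x₀ t₀ = -spatialGrad η x₀ t₀ := by
    simp only [spatialGrad, gradient]
    rw [fderiv_fun_neg, map_neg]
  have ht : timeD (fun z => -η z) x₀ t₀ = -timeD η x₀ t₀ := by
    simp only [timeD]
    rw [deriv.fun_neg]
  have hd : ∀ i j, spatialD2 (fun z => -η z) x₀ t₀ i j = -spatialD2 η x₀ t₀ i j := by
    intro i j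
    simp only [spatialD2]
    have : (fun y => fderiv ℝ (fun z => -η (z, t₀)) y (evec d j)) =
        fun y => -(fderiv ℝ (fun z => η (z, t₀)) y (evec d j)) := by
      funext y
      rw [fderiv_fun_neg]
      rfl
    rw [this, fderiv_fun_neg]
    rfl
  have := hvisc (fun z => -η z) hη.neg x₀ t₀ ht₀ (by
    have h1 := hmax.neg
    refine h1.congr (Eventually.of_forall fun p => ?_)
    simp
    ring) (neg_lt_neg_iff.1 hlt)
  simp only [hg, ht, hd, neg_eq_zero, ne_eq, norm_neg, inner_neg_left, mul_neg, neg_mul, neg_neg,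
    Finset.sum_neg_distrib, ge_iff_le, neg_le_neg_iff] at this
  exact this

end Superjet

section SupConvolution

/-- An even kernel which is quartic in space near the origin, quadratic in time, and which has a
globally bounded Hessian. -/
def quarticKernel (ξ : SpaceTime d) : ℝ := (√(1 + ‖ξ.fst‖ ^ 2) - 1) ^ 2 + ξ.snd ^ 2

/-- The gradient of `quarticKernel`. -/
def quarticKernelSlope (ξ : SpaceTime d) : SpaceTime d :=
  WithLp.toLp 2 ((2 * (1 - (√(1 + ‖ξ.fst‖ ^ 2))⁻¹)) • ξ.fst, 2 * ξ.snd)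

lemma quarticKernel_nonneg (ξ : SpaceTime d) : 0 ≤ quarticKernel ξ :=
  add_nonneg (sq_nonneg _) (sq_nonneg _)

lemma quarticKernel_zero : quarticKernel (0 : SpaceTime d) = 0 := by
  simp [quarticKernel]

lemma quarticKernel_add_le (ξ e : SpaceTime d) :
    quarticKernel (ξ + e) ≤ quarticKernel ξ + ⟪quarticKernelSlope ξ, e⟫ + ‖e‖ ^ 2 := by
  have hcs : ∀ x y : EuclideanSpace ℝ (Fin d),
      1 + ⟪x, y⟫ ≤ √(1 + ‖x‖ ^ 2) * √(1 + ‖y‖ ^ 2) := by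
    intro x y
    rw [← Real.sqrt_mul (by positivity)]
    refine Real.le_sqrt_of_sq_le ?_
    have h := abs_le.1 (abs_real_inner_le_norm x y)
    have h1 : ⟪x, y⟫ ^ 2 ≤ (‖x‖ * ‖y‖) ^ 2 := sq_le_sq' h.1 h.2
    nlinarith [sq_nonneg (‖x‖ - ‖y‖), h.2]
  have hcs := hcs ξ.fst (ξ.fst + e.fst)
  have hs := Real.sq_sqrt (show 0 ≤ 1 + ‖ξ.fst‖ ^ 2 by positivity)
  have hs' := Real.sq_sqrt (show 0 ≤ 1 + ‖ξ.fst + e.fst‖ ^ 2 by positivity)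
  have hpos : 0 < √(1 + ‖ξ.fst‖ ^ 2) := by positivity
  rw [SpaceTime.inner_eq, SpaceTime.norm_sq_eq]
  have hslope : ⟪(quarticKernelSlope ξ).fst, e.fst⟫ =
      2 * (1 - (√(1 + ‖ξ.fst‖ ^ 2))⁻¹) * ⟪ξ.fst, e.fst⟫ := real_inner_smul_left ..
  have hslope' : (quarticKernelSlope ξ).snd = 2 * ξ.snd := rfl
  rw [hslope, hslope']
  simp only [quarticKernel, WithLp.add_fst, WithLp.add_snd]
  rw [inner_add_right, real_inner_self_eq_norm_sq] at hcs
  set s := √(1 + ‖ξ.fst‖ ^ 2)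
  set s' := √(1 + ‖ξ.fst + e.fst‖ ^ 2)
  have hn := norm_add_sq_real ξ.fst e.fst
  have hkey : s + s⁻¹ * ⟪ξ.fst, e.fst⟫ ≤ s' := by
    refine le_of_mul_le_mul_left ?_ hpos
    rw [mul_add, mul_inv_cancel_left₀ hpos.ne']
    nlinarith
  nlinarith

lemma quarticKernel_le (ξ : SpaceTime d) : quarticKernel ξ ≤ ‖ξ.fst‖ ^ 4 / 4 + ξ.snd ^ 2 := by
  have hs := Real.sq_sqrt (show 0 ≤ 1 + ‖ξ.fst‖ ^ 2 by positivity)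
  have h1 : 1 ≤ √(1 + ‖ξ.fst‖ ^ 2) := Real.one_le_sqrt.2 (by nlinarith [sq_nonneg ‖ξ.fst‖])
  rw [quarticKernel]
  set s := √(1 + ‖ξ.fst‖ ^ 2)
  have h2 : s - 1 ≤ ‖ξ.fst‖ ^ 2 / 2 := by nlinarith
  have h3 : (s - 1) ^ 2 ≤ (‖ξ.fst‖ ^ 2 / 2) ^ 2 := by gcongr
  nlinarith

lemma norm_sq_le_of_quarticKernel_le {ξ : SpaceTime d} {ε : ℝ} (hε : 0 ≤ ε)
    (h : quarticKernel ξ ≤ ε ^ 2) : ‖ξ‖ ^ 2 ≤ 2 * ε + 2 * ε ^ 2 := by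
  have hs := Real.sq_sqrt (show 0 ≤ 1 + ‖ξ.fst‖ ^ 2 by positivity)
  rw [quarticKernel] at h
  rw [SpaceTime.norm_sq_eq]
  set s := √(1 + ‖ξ.fst‖ ^ 2)
  have h1 : s - 1 ≤ ε := (abs_le_of_sq_le_sq' (by nlinarith [sq_nonneg ξ.snd]) hε).2
  have h2 : 0 ≤ s := Real.sqrt_nonneg _
  nlinarith [sq_nonneg ξ.snd, sq_nonneg (s - 1)]

lemma fst_eq_zero_of_quarticKernelSlope {ξ : SpaceTime d}
    (h : (quarticKernelSlope ξ).fst = 0) : ξ.fst = 0 := by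
  by_contra hne
  rcases smul_eq_zero.1 (show (2 * (1 - (√(1 + ‖ξ.fst‖ ^ 2))⁻¹)) • ξ.fst = 0 from h) with h0 | h0
  · have h1 : 1 < √(1 + ‖ξ.fst‖ ^ 2) := by
      have := norm_pos_iff.2 hne
      exact Real.lt_sqrt_of_sq_lt (by nlinarith)
    have := inv_lt_one_of_one_lt₀ h1
    linarith
  · exact hne h0

lemma continuous_quarticKernel : Continuous (quarticKernel : SpaceTime d → ℝ) := by
  have h1 : Continuous fun ξ : SpaceTime d => ξ.fst := WithLp.continuous_fst ..
  have h2 : Continuous fun ξ : SpaceTime d => ξ.snd := WithLp.continuous_snd ..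
  unfold quarticKernel
  fun_prop

/-- The supremum in the sup-convolution of a continuous function bounded from above is attained. -/
lemma exists_forall_sub_quarticKernel_le {a : SpaceTime d → ℝ} (ha : Continuous a) {A L : ℝ}
    (hA : ∀ Z, a Z ≤ A) (hL : 0 < L) (X : SpaceTime d) :
    ∃ Z, ∀ Y, a Y - L * quarticKernel (X - Y) ≤ a Z - L * quarticKernel (X - Z) := by
  obtain ⟨ε, hε, hε'⟩ : ∃ ε : ℝ, 0 < ε ∧ A - a X ≤ L * ε ^ 2 := by
    refine ⟨(A - a X) / L + 1, ?_, ?_⟩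
    · have := div_nonneg (sub_nonneg.2 (hA X)) hL.le
      linarith
    · have h0 := div_nonneg (sub_nonneg.2 (hA X)) hL.le
      have h1 : (A - a X) / L ≤ ((A - a X) / L + 1) ^ 2 := by nlinarith
      calc A - a X = L * ((A - a X) / L) := by field_simp
        _ ≤ _ := by gcongr
  obtain ⟨Z, -, hZ⟩ := (isCompact_closedBall X (2 * ε + 2)).exists_isMaxOn
    (f := fun Y => a Y - L * quarticKernel (X - Y)) ⟨X, Metric.mem_closedBall_self (by positivity)⟩
    (ha.sub (continuous_const.mul
      (continuous_quarticKernel.comp (continuous_const.sub continuous_id)))).continuousOn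
  have hX : a X ≤ a Z - L * quarticKernel (X - Z) := by
    have : a X - L * quarticKernel (X - X) ≤ a Z - L * quarticKernel (X - Z) :=
      hZ (Metric.mem_closedBall_self (by positivity))
    rwa [sub_self, quarticKernel_zero, mul_zero, sub_zero] at this
  refine ⟨Z, fun Y => ?_⟩
  by_cases hY : Y ∈ Metric.closedBall X (2 * ε + 2)
  · exact hZ hY
  · rw [Metric.mem_closedBall, not_le, dist_comm, dist_eq_norm] at hY
    have h1 : ε ^ 2 < quarticKernel (X - Y) := by
      by_contra! h
      have := norm_sq_le_of_quarticKernel_le hε.le h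
      nlinarith
    have h2 : L * ε ^ 2 < L * quarticKernel (X - Y) := by gcongr
    linarith [hA Y]

variable {a : SpaceTime d → ℝ} {L : ℝ} {Z : SpaceTime d → SpaceTime d}

lemma isSemiconvexSlope_supConvolution (hL : 0 ≤ L)
    (hZ : ∀ X Y, a Y - L * quarticKernel (X - Y) ≤ a (Z X) - L * quarticKernel (X - Z X)) :
    IsSemiconvexSlope L (fun X => a (Z X) - L * quarticKernel (X - Z X))
      (fun X => -(L • quarticKernelSlope (X - Z X))) := by
  intro X Y
  refine le_trans ?_ (hZ Y (Z X))
  have h := quarticKernel_add_le (X - Z X) (Y - X)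
  rw [show X - Z X + (Y - X) = Y - Z X by abel] at h
  have := mul_le_mul_of_nonneg_left h hL
  simp only [inner_neg_left, real_inner_smul_left]
  linarith

lemma supConvolution_add (hZ : ∀ X Y, a Y - L * quarticKernel (X - Y) ≤
      a (Z X) - L * quarticKernel (X - Z X)) {l : SpaceTime d} (hl : ∀ X, a (X + l) = a X)
    (X : SpaceTime d) : a (Z (X + l)) - L * quarticKernel (X + l - Z (X + l)) =
      a (Z X) - L * quarticKernel (X - Z X) := by
  refine le_antisymm ?_ ?_
  · have h := hZ X (Z (X + l) - l)
    have h1 := hl (Z (X + l) - l)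
    rw [sub_add_cancel] at h1
    rwa [← h1, show X - (Z (X + l) - l) = X + l - Z (X + l) by abel] at h
  · have h := hZ (X + l) (Z X + l)
    rwa [hl, add_sub_add_right_eq_sub] at h

lemma supConvolution_superjet (hL : 0 ≤ L)
    (hZ : ∀ X Y, a Y - L * quarticKernel (X - Y) ≤ a (Z X) - L * quarticKernel (X - Z X))
    {X : SpaceTime d} {D : SpaceTime d →L[ℝ] SpaceTime d}
    (hD : HasFDerivAt (fun X => -(L • quarticKernelSlope (X - Z X))) D X) {σ : ℝ} (hσ : 0 < σ) :
    ∀ᶠ e in 𝓝 0, a (Z X + e) ≤ a (Z X) + ⟪-(L • quarticKernelSlope (X - Z X)), e⟫ +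
      1 / 2 * ⟪D e, e⟫ + σ * ‖e‖ ^ 2 := by
  filter_upwards [(isSemiconvexSlope_supConvolution hL hZ).abs_taylor_le hD hσ] with e he
  have h := hZ (X + e) (Z X + e)
  rw [add_sub_add_right_eq_sub] at h
  have := (abs_le.1 he).2
  linarith

end SupConvolution

section Periodic

/-- An integer vector as a point of Euclidean space. -/
def latticeVec (k : Fin d → ℤ) : EuclideanSpace ℝ (Fin d) :=
  (WithLp.equiv 2 (Fin d → ℝ)).symm fun i => (k i : ℝ)

lemma exists_norm_add_latticeVec_le (x : EuclideanSpace ℝ (Fin d)) :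
    ∃ k : Fin d → ℤ, ‖x + latticeVec k‖ ≤ √d := by
  refine ⟨fun i => -⌊x i⌋, ?_⟩
  rw [EuclideanSpace.norm_eq]
  refine Real.sqrt_le_sqrt ?_
  have h : ∀ i ∈ Finset.univ, ‖(x + latticeVec fun i => -⌊x i⌋) i‖ ^ 2 ≤ 1 := by
    intro i _
    have h1 : (x + latticeVec fun i => -⌊x i⌋) i = Int.fract (x i) := by
      simp [latticeVec, Int.fract, sub_eq_add_neg]
    rw [h1, Real.norm_of_nonneg (Int.fract_nonneg _)]
    exact pow_le_one₀ (Int.fract_nonneg _) (Int.fract_lt_one _).le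
  exact (Finset.sum_le_sum h).trans (by simp)

variable {F : SpaceTime d → ℝ}

lemma exists_modulus_of_periodic (hF : Continuous F)
    (hper : ∀ X k, F (X + spaceIncl d (latticeVec k)) = F X) {ε : ℝ} (hε : 0 < ε) :
    ∃ δ > 0, ∀ x Y, dist (spaceIncl d x) Y < δ → |F (spaceIncl d x) - F Y| < ε := by
  have hK : IsCompact (spaceIncl d '' Metric.closedBall 0 √d) :=
    (isCompact_closedBall _ _).image (spaceIncl d).continuous
  have h := hK.uniformContinuousAt_of_continuousAt F (fun X _ => hF.continuousAt)
    (Metric.dist_mem_uniformity hε)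
  obtain ⟨δ, hδ, h⟩ := Metric.mem_uniformity_dist.1 h
  refine ⟨δ, hδ, fun x Y hxY => ?_⟩
  obtain ⟨k, hk⟩ := exists_norm_add_latticeVec_le x
  rw [← hper (spaceIncl d x) k, ← hper Y k, ← map_add, ← Real.dist_eq]
  refine h ?_ ⟨_, mem_closedBall_zero_iff.2 hk, rfl⟩
  rwa [map_add, dist_add_right]

lemma exists_forall_ge_of_periodic (hF : Continuous F)
    (hper : ∀ X k, F (X + spaceIncl d (latticeVec k)) = F X) {m T : ℝ}
    (hT : ∀ X, m ≤ F X → |X.snd| ≤ T) {X₁ : SpaceTime d} (hX₁ : m ≤ F X₁) :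
    ∃ X₀, ∀ X, F X ≤ F X₀ := by
  have hred : ∀ X, m ≤ F X → ∃ Y ∈ Metric.closedBall (0 : SpaceTime d) (√d + T), F Y = F X := by
    intro X hX
    obtain ⟨k, hk⟩ := exists_norm_add_latticeVec_le X.fst
    refine ⟨X + spaceIncl d (latticeVec k), ?_, hper X k⟩
    have hXT := hT X hX
    have hT0 : 0 ≤ T := (abs_nonneg _).trans hXT
    rw [mem_closedBall_zero_iff]
    refine (abs_le_of_sq_le_sq' ?_ (by positivity)).2
    rw [SpaceTime.norm_sq_eq]
    simp only [WithLp.add_fst, WithLp.add_snd, spaceIncl_fst, spaceIncl_snd, add_zero]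
    have h1 : ‖X.fst + latticeVec k‖ ^ 2 ≤ √d ^ 2 := by gcongr
    have h2 : X.snd ^ 2 ≤ T ^ 2 := sq_le_sq' (abs_le.1 hXT).1 (abs_le.1 hXT).2
    nlinarith [Real.sqrt_nonneg d]
  obtain ⟨Y₁, hY₁, hY₁F⟩ := hred X₁ hX₁
  obtain ⟨X₀, -, hX₀⟩ := (isCompact_closedBall (0 : SpaceTime d) (√d + T)).exists_isMaxOn
    ⟨Y₁, hY₁⟩ hF.continuousOn
  refine ⟨X₀, fun X => ?_⟩
  rcases le_or_gt m (F X) with h | h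
  · obtain ⟨Y, hY, hYF⟩ := hred X h
    exact hYF ▸ hX₀ hY
  · exact h.le.trans (hX₁.trans (hY₁F ▸ hX₀ hY₁))

end Periodic

section Comparison

/-- The orthogonal projection of space-time to the time axis. -/
def timeProj (d : ℕ) : SpaceTime d →L[ℝ] SpaceTime d :=
  InnerProductSpace.rankOne ℝ (timeVec d) (timeVec d)

lemma timeProj_apply (e : SpaceTime d) : timeProj d e = e.snd • timeVec d := by
  have : ⟪timeVec d, e⟫ = e.snd := by simp
  rw [timeProj, InnerProductSpace.rankOne_apply, this]

lemma inner_timeProj_self (e : SpaceTime d) : ⟪timeProj d e, e⟫ = e.snd ^ 2 := by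
  rw [timeProj_apply, real_inner_smul_left, SpaceTime.inner_eq]
  simp
  ring

lemma timeProj_spaceIncl (x : EuclideanSpace ℝ (Fin d)) : timeProj d (spaceIncl d x) = 0 := by
  rw [timeProj_apply, spaceIncl_snd, zero_smul]

lemma norm_evec (i : Fin d) : ‖evec d i‖ = 1 := by
  simp [evec]

lemma spatialTrace_add (D₁ D₂ : SpaceTime d →L[ℝ] SpaceTime d) :
    spatialTrace (D₁ + D₂) = spatialTrace D₁ + spatialTrace D₂ := by
  simp [spatialTrace, inner_add_left, Finset.sum_add_distrib]

lemma spatialTrace_smul (c : ℝ) (D : SpaceTime d →L[ℝ] SpaceTime d) :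
    spatialTrace (c • D) = c * spatialTrace D := by
  simp only [spatialTrace, smul_apply, real_inner_smul_left, Finset.mul_sum]

lemma spatialTrace_id : spatialTrace (ContinuousLinearMap.id ℝ (SpaceTime d)) = d := by
  simp only [spatialTrace, ContinuousLinearMap.id_apply, real_inner_self_eq_norm_sq,
    norm_spaceIncl, norm_evec]
  simp

lemma spatialTrace_timeProj : spatialTrace (timeProj d) = 0 := by
  simp [spatialTrace, timeProj_spaceIncl]

/-- The trace of an operator over the orthogonal complement of a unit vector. -/
lemma spatialTrace_sub_eq_sum (D : SpaceTime d →L[ℝ] SpaceTime d)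
    {a : EuclideanSpace ℝ (Fin d)} (ha : ‖a‖ = 1) :
    spatialTrace D - ⟪D (spaceIncl d a), spaceIncl d a⟫ =
      ∑ i, ⟪D (spaceIncl d (evec d i - ⟪a, evec d i⟫ • a)),
        spaceIncl d (evec d i - ⟪a, evec d i⟫ • a)⟫ := by
  have h1 : ∑ i, ⟪a, evec d i⟫ * ⟪D (spaceIncl d (evec d i)), spaceIncl d a⟫ =
      ⟪D (spaceIncl d a), spaceIncl d a⟫ := by
    simp only [← real_inner_smul_left, ← sum_inner, ← map_smul, ← map_sum, sum_inner_evec_smul]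
  have h2 : ∑ i, ⟪a, evec d i⟫ * ⟪D (spaceIncl d a), spaceIncl d (evec d i)⟫ =
      ⟪D (spaceIncl d a), spaceIncl d a⟫ := by
    simp only [← real_inner_smul_right, ← inner_sum, ← map_smul, ← map_sum, sum_inner_evec_smul]
  have h3 : ∑ i, ⟪a, evec d i⟫ ^ 2 = 1 := by
    have : ∑ i, ⟪a, evec d i⟫ ^ 2 = ⟪a, ∑ i, ⟪a, evec d i⟫ • evec d i⟫ := by
      simp only [inner_sum, real_inner_smul_right, sq]
    rw [this, sum_inner_evec_smul, real_inner_self_eq_norm_sq, ha, one_pow]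
  have h4 : ∀ i, ⟪D (spaceIncl d (evec d i - ⟪a, evec d i⟫ • a)),
        spaceIncl d (evec d i - ⟪a, evec d i⟫ • a)⟫ =
      ⟪D (spaceIncl d (evec d i)), spaceIncl d (evec d i)⟫ -
        ⟪a, evec d i⟫ * ⟪D (spaceIncl d (evec d i)), spaceIncl d a⟫ -
        ⟪a, evec d i⟫ * ⟪D (spaceIncl d a), spaceIncl d (evec d i)⟫ +
        ⟪a, evec d i⟫ ^ 2 * ⟪D (spaceIncl d a), spaceIncl d a⟫ := by
    intro i
    simp only [map_sub, map_smul, inner_sub_left, inner_sub_right, real_inner_smul_left,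
      real_inner_smul_right]
    ring
  simp only [h4, Finset.sum_add_distrib, Finset.sum_sub_distrib, h1, h2, ← Finset.sum_mul, h3]
  rw [spatialTrace]
  ring

/-- Continuity of a bounded quadratic form on the unit sphere, with antipodes identified. -/
lemma inner_sub_inner_le_of_norm_add_le {V : Type*} [NormedAddCommGroup V]
    [InnerProductSpace ℝ V] {D : V →L[ℝ] V} {K C η : ℝ} (hη : 0 < η)
    (hlow : ∀ e, -C * ‖e‖ ^ 2 ≤ ⟪D e, e⟫) (hup : ∀ e, ⟪D e, e⟫ ≤ K * ‖e‖ ^ 2) {a b : V}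
    (ha : ‖a‖ = 1) (hb : ‖b‖ = 1) (hab : ‖a + b‖ ≤ η) :
    ⟪D a, a⟫ - ⟪D b, b⟫ ≤ (K + C) * (2 * η + η ^ 2) := by
  have hKC : 0 ≤ K + C := by
    have h1 := hlow a
    have h2 := hup a
    rw [ha] at h1 h2
    linarith
  have h1 := hlow (η • b + (a + b))
  have h2 := hup b
  have h3 := hup (a + b)
  have h4 := hlow b
  have hn : ‖η • b + (a + b)‖ ^ 2 = η ^ 2 + 2 * η * ⟪b, a + b⟫ + ‖a + b‖ ^ 2 := by
    rw [norm_add_sq_real, norm_smul, Real.norm_of_nonneg hη.le, hb, real_inner_smul_left]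
    ring
  have hn' : ‖a‖ ^ 2 = ‖a + b‖ ^ 2 - 2 * ⟪b, a + b⟫ + 1 := by
    have h := norm_sub_sq_real (a + b) b
    rw [add_sub_cancel_right, hb, real_inner_comm] at h
    linarith
  have hD : ⟪D (η • b + (a + b)), η • b + (a + b)⟫ = η ^ 2 * ⟪D b, b⟫ +
      η * (⟪D b, a + b⟫ + ⟪D (a + b), b⟫) + ⟪D (a + b), a + b⟫ := by
    simp only [map_add, map_smul, inner_add_left, inner_add_right, real_inner_smul_left,
      real_inner_smul_right]
    ring
  have hD' : ⟪D a, a⟫ = ⟪D (a + b), a + b⟫ - (⟪D b, a + b⟫ + ⟪D (a + b), b⟫) + ⟪D b, b⟫ := by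
    simp only [map_add, inner_add_left, inner_add_right]
    ring
  rw [ha] at hn'
  rw [hb] at h2 h4
  have h5 : ‖a + b‖ ^ 2 ≤ η ^ 2 := by gcongr
  rw [hn, hD] at h1
  have h6 : η * (⟪D a, a⟫ - ⟪D b, b⟫) ≤ η * ((K + C) * (2 * η + η ^ 2)) := by
    rw [hD']
    generalize ⟪D b, a + b⟫ + ⟪D (a + b), b⟫ = m at *
    generalize ⟪D (a + b), a + b⟫ = n at *
    generalize ⟪D b, b⟫ = o at *
    generalize ⟪b, a + b⟫ = l at *
    have hl : l = ‖a + b‖ ^ 2 / 2 := by linarith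
    subst hl
    have h7 : n ≤ K * ‖a + b‖ ^ 2 := h3
    have h8 : η ^ 2 * o ≤ η ^ 2 * K := by nlinarith [sq_nonneg η]
    have h9 : (K + C) * ‖a + b‖ ^ 2 ≤ (K + C) * η ^ 2 := by gcongr
    nlinarith [mul_le_mul_of_nonneg_left h9 hη.le, mul_le_mul_of_nonneg_left h7 hη.le]
  exact le_of_mul_le_mul_left h6 hη

lemma norm_normalize_add_normalize_le {V : Type*} [NormedAddCommGroup V] [NormedSpace ℝ V]
    {x y : V} (hx : x ≠ 0) (hy : y ≠ 0) {r : ℝ} (h : ‖x + y‖ ≤ r) :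
    ‖‖x‖⁻¹ • x + ‖y‖⁻¹ • y‖ ≤ 2 * r / ‖x‖ := by
  have hx' := norm_pos_iff.2 hx
  have hy' := norm_pos_iff.2 hy
  have e : ‖x‖⁻¹ • x + ‖y‖⁻¹ • y = ‖x‖⁻¹ • (x + y) + (‖y‖⁻¹ - ‖x‖⁻¹) • y := by module
  have h1 : ‖(‖y‖⁻¹ - ‖x‖⁻¹) • y‖ = ‖x‖⁻¹ * |‖x‖ - ‖y‖| := by
    have h : ‖y‖⁻¹ - ‖x‖⁻¹ = ‖x‖⁻¹ * (‖x‖ - ‖y‖) * ‖y‖⁻¹ := by field_simp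
    rw [norm_smul, Real.norm_eq_abs, h, abs_mul, abs_mul, abs_inv, abs_inv, abs_norm, abs_norm,
      inv_mul_cancel_right₀ hy'.ne']
  have h2 : |‖x‖ - ‖y‖| ≤ ‖x + y‖ := by
    have := abs_norm_sub_norm_le x (-y)
    rwa [norm_neg, sub_neg_eq_add] at this
  calc ‖‖x‖⁻¹ • x + ‖y‖⁻¹ • y‖ ≤ ‖‖x‖⁻¹ • (x + y)‖ + ‖(‖y‖⁻¹ - ‖x‖⁻¹) • y‖ := by
        rw [e]; exact norm_add_le _ _
    _ ≤ ‖x‖⁻¹ * r + ‖x‖⁻¹ * r := by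
        rw [h1, norm_smul, norm_inv, norm_norm]
        gcongr
        exact h2.trans h
    _ = 2 * r / ‖x‖ := by field_simp; ring

/-- Two curvature operators, with almost opposite normals, of Hessians with almost nonpositive
sum. -/
lemma curvature_add_curvature_le {D₁ D₂ : SpaceTime d →L[ℝ] SpaceTime d} {C c η : ℝ}
    (hc : 0 ≤ c) (hη : 0 < η) (h₁ : ∀ e, -(2 * C) * ‖e‖ ^ 2 ≤ ⟪D₁ e, e⟫)
    (h₂ : ∀ e, -(2 * C) * ‖e‖ ^ 2 ≤ ⟪D₂ e, e⟫)
    (h : ∀ e, ⟪D₁ e, e⟫ + ⟪D₂ e, e⟫ ≤ 2 * c * ‖e‖ ^ 2)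
    {a b : EuclideanSpace ℝ (Fin d)} (ha : ‖a‖ = 1) (hb : ‖b‖ = 1) (hab : ‖a + b‖ ≤ η) :
    (spatialTrace D₁ - ⟪D₁ (spaceIncl d a), spaceIncl d a⟫) +
      (spatialTrace D₂ - ⟪D₂ (spaceIncl d b), spaceIncl d b⟫) ≤
      2 * c * d + (2 * c + 4 * C) * (2 * η + η ^ 2) := by
  have hup : ∀ e, ⟪D₂ e, e⟫ ≤ (2 * c + 2 * C) * ‖e‖ ^ 2 := fun e => by
    have := h e
    have := h₁ e
    linarith
  have hab' : ‖spaceIncl d a + spaceIncl d b‖ ≤ η := by rwa [← map_add, norm_spaceIncl]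
  have key := inner_sub_inner_le_of_norm_add_le hη h₂ hup ((norm_spaceIncl a).trans ha)
    ((norm_spaceIncl b).trans hb) hab'
  have htr : spatialTrace (D₁ + D₂) - ⟪(D₁ + D₂) (spaceIncl d a), spaceIncl d a⟫ ≤
      2 * c * d := by
    rw [spatialTrace_sub_eq_sum _ ha]
    refine (Finset.sum_le_sum (g := fun _ => 2 * c) fun i _ => ?_).trans_eq (by simp [mul_comm])
    rw [add_apply, inner_add_left]
    refine (h _).trans ?_
    rw [norm_spaceIncl, norm_sub_sq_real, norm_evec, norm_smul, ha, real_inner_smul_right,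
      real_inner_comm, Real.norm_eq_abs, mul_one, sq_abs]
    nlinarith [sq_nonneg ⟪a, evec d i⟫]
  rw [spatialTrace_add, add_apply, inner_add_left] at htr
  have e : (2 * c + 2 * C + 2 * C) = 2 * c + 4 * C := by ring
  rw [e] at key
  linarith

/-- A space-time function, extended to negative times and penalized at large times. -/
def penalized (u : EuclideanSpace ℝ (Fin d) → ℝ → ℝ) (l : ℝ) (Z : SpaceTime d) : ℝ :=
  u Z.fst (max Z.snd 0) - l * Z.snd ^ 2

variable {φ ψ : EuclideanSpace ℝ (Fin d) → ℝ} {u : EuclideanSpace ℝ (Fin d) → ℝ → ℝ}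

lemma IsViscositySubsol.continuous_penalized (hu : IsViscositySubsol φ ψ u) (l : ℝ) :
    Continuous (penalized u l) := by
  have h1 : Continuous fun Z : SpaceTime d => Z.fst := WithLp.continuous_fst ..
  have h2 : Continuous fun Z : SpaceTime d => Z.snd := WithLp.continuous_snd ..
  have h3 : Continuous fun Z : SpaceTime d => (Z.fst, max Z.snd 0) :=
    h1.prodMk (h2.max continuous_const)
  exact (hu.1.comp_continuous h3 fun Z => ⟨trivial, le_max_right Z.snd 0⟩).sub
    (continuous_const.mul (h2.pow 2))

lemma IsViscositySubsol.penalized_add_latticeVec (hu : IsViscositySubsol φ ψ u) (l : ℝ)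
    (Z : SpaceTime d) (k : Fin d → ℤ) :
    penalized u l (Z + spaceIncl d (latticeVec k)) = penalized u l Z := by
  have := hu.2.2.1 (max Z.snd 0) Z.fst k
  simp only [penalized, WithLp.add_fst, WithLp.add_snd, spaceIncl_fst, spaceIncl_snd, add_zero]
  exact congrArg (· - l * Z.snd ^ 2) this

lemma IsViscositySubsol.penalized_superjet (hu : IsViscositySubsol φ ψ u) {l σ : ℝ}
    {Z P : SpaceTime d} {D : SpaceTime d →L[ℝ] SpaceTime d} (hσ : 0 ≤ σ) (ht : 0 < Z.snd)
    (hφ : φ Z.fst < u Z.fst (max Z.snd 0))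
    (h : ∀ᶠ e in 𝓝 0, penalized u l (Z + e) ≤
      penalized u l Z + ⟪P, e⟫ + 1 / 2 * ⟪D e, e⟫ + σ * ‖e‖ ^ 2) :
    ∃ ζ : EuclideanSpace ℝ (Fin d), ‖ζ‖ ≤ 1 ∧ (P.fst ≠ 0 → ζ = ‖P.fst‖⁻¹ • P.fst) ∧
      P.snd + 2 * l * Z.snd ≤
        spatialTrace D - ⟪D (spaceIncl d ζ), spaceIncl d ζ⟫ + 2 * σ * d := by
  rw [max_eq_left ht.le] at hφ
  have hpos : ∀ᶠ e in 𝓝 (0 : SpaceTime d), 0 < (Z + e).snd := by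
    have : Continuous fun e : SpaceTime d => (Z + e).snd :=
      (WithLp.continuous_snd ..).comp (continuous_const.add continuous_id)
    have := this.tendsto 0
    rw [add_zero] at this
    exact this.eventually_const_lt ht
  obtain ⟨ζ, hζ, hζP, hineq⟩ := hu.superjet (Z := Z) (P := P + (2 * l * Z.snd) • timeVec d)
    (D := D + (2 * σ) • ContinuousLinearMap.id ℝ (SpaceTime d) + (2 * l) • timeProj d) ht hφ (by
      filter_upwards [h, hpos] with e he hpe
      simp only [penalized, max_eq_left hpe.le, max_eq_left ht.le] at he
      have h1 : ⟪timeVec d, e⟫ = e.snd := by simp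
      simp only [add_apply, smul_apply, ContinuousLinearMap.id_apply, inner_add_left,
        real_inner_smul_left, inner_timeProj_self, real_inner_self_eq_norm_sq, h1]
      rw [WithLp.add_snd] at he ⊢
      nlinarith)
  have hfst : (P + (2 * l * Z.snd) • timeVec d).fst = P.fst := by simp
  have hsnd : (P + (2 * l * Z.snd) • timeVec d).snd = P.snd + 2 * l * Z.snd := by simp
  rw [hfst] at hζP
  refine ⟨ζ, hζ, hζP, ?_⟩
  rw [hsnd, spatialTrace_add, spatialTrace_add, spatialTrace_smul, spatialTrace_smul,
    spatialTrace_id, spatialTrace_timeProj] at hineq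
  simp only [add_apply, smul_apply, ContinuousLinearMap.id_apply, inner_add_left,
    real_inner_smul_left, timeProj_spaceIncl, inner_zero_left, smul_zero,
    real_inner_self_eq_norm_sq] at hineq
  nlinarith [mul_nonneg hσ (sq_nonneg ‖spaceIncl d ζ‖)]

end Comparison

section Doubling

variable {φ₁ ψ₁ φ₂ ψ₂ : EuclideanSpace ℝ (Fin d) → ℝ}
  {u₁ u₂ : EuclideanSpace ℝ (Fin d) → ℝ → ℝ}

lemma exists_modulus_obstacle {φ : EuclideanSpace ℝ (Fin d) → ℝ} (hφ : Continuous φ)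
    (hp : ZPeriodic φ) {ε : ℝ} (hε : 0 < ε) :
    ∃ δ > 0, ∀ x y, dist x y < δ → |φ x - φ y| < ε := by
  have h1 : Continuous fun X : SpaceTime d => φ X.fst := hφ.comp (WithLp.continuous_fst ..)
  obtain ⟨δ, hδ, h⟩ := exists_modulus_of_periodic h1 (fun X k => hp X.fst k) hε
  refine ⟨δ, hδ, fun x y hxy => h x (spaceIncl d y) ?_⟩
  rwa [dist_eq_norm, ← map_sub, norm_spaceIncl, ← dist_eq_norm]

lemma SpaceTime.norm_fst_le (X : SpaceTime d) : ‖X.fst‖ ≤ ‖X‖ :=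
  (abs_le_of_sq_le_sq' (by rw [SpaceTime.norm_sq_eq X]; nlinarith [sq_nonneg X.snd])
    (norm_nonneg X)).2

lemma SpaceTime.abs_snd_le (X : SpaceTime d) : |X.snd| ≤ ‖X‖ :=
  (abs_le_of_sq_le_sq' (by rw [SpaceTime.norm_sq_eq X, sq_abs]; nlinarith [sq_nonneg ‖X.fst‖])
    (norm_nonneg X)).2

lemma norm_spaceIncl_sub_toLp_sq (x y : EuclideanSpace ℝ (Fin d)) (s : ℝ) :
    ‖spaceIncl d x - WithLp.toLp 2 (y, s)‖ ^ 2 = ‖x - y‖ ^ 2 + s ^ 2 := by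
  rw [SpaceTime.norm_sq_eq, WithLp.sub_fst, WithLp.sub_snd, spaceIncl_fst, spaceIncl_snd,
    zero_sub, neg_sq]
  rfl

/-- Nearby points at which the sum of the two functions is not small lie away from the obstacles
and from the initial time. -/
lemma exists_separation (h₁ : IsViscositySubsol φ₁ ψ₁ u₁) (h₂ : IsViscositySubsol φ₂ ψ₂ u₂)
    (hφ₁ : Continuous φ₁) (hφ₂ : Continuous φ₂) (hp₁ : ZPeriodic φ₁) (hp₂ : ZPeriodic φ₂)
    (hψ₁ : ∀ x, ψ₁ x ≤ -φ₂ x) (hψ₂ : ∀ x, ψ₂ x ≤ -φ₁ x) (hinit : ∀ x, u₁ x 0 + u₂ x 0 ≤ 0)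
    {θ : ℝ} (hθ : 0 < θ) :
    ∃ δ > 0, ∀ Z W : SpaceTime d, dist Z W ≤ δ →
      θ ≤ u₁ Z.fst (max Z.snd 0) + u₂ W.fst (max W.snd 0) →
      φ₁ Z.fst < u₁ Z.fst (max Z.snd 0) ∧ φ₂ W.fst < u₂ W.fst (max W.snd 0) ∧
        δ < Z.snd ∧ δ < W.snd := by
  obtain ⟨δ₁, hδ₁, hu₁⟩ := exists_modulus_of_periodic (h₁.continuous_penalized 0)
    (h₁.penalized_add_latticeVec 0) (half_pos hθ)
  obtain ⟨δ₂, hδ₂, hu₂⟩ := exists_modulus_of_periodic (h₂.continuous_penalized 0)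
    (h₂.penalized_add_latticeVec 0) (half_pos hθ)
  obtain ⟨δ₃, hδ₃, hm₁⟩ := exists_modulus_obstacle hφ₁ hp₁ hθ
  obtain ⟨δ₄, hδ₄, hm₂⟩ := exists_modulus_obstacle hφ₂ hp₂ hθ
  obtain ⟨δ, hδ, hle⟩ : ∃ δ > 0, 4 * δ ≤ min (min δ₁ δ₂) (min δ₃ δ₄) :=
    ⟨min (min δ₁ δ₂) (min δ₃ δ₄) / 4, by positivity, by linarith⟩
  simp only [le_min_iff] at hle
  obtain ⟨⟨hl₁, hl₂⟩, hl₃, hl₄⟩ := hle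
  refine ⟨δ, hδ, fun Z W hZW hsum => ?_⟩
  rw [dist_eq_norm] at hZW
  have hfst : ‖Z.fst - W.fst‖ ≤ δ := (SpaceTime.norm_fst_le (Z - W)).trans hZW
  have hsnd : |Z.snd - W.snd| ≤ δ := (SpaceTime.abs_snd_le (Z - W)).trans hZW
  have hdist : dist Z.fst W.fst ≤ δ := by rwa [dist_eq_norm]
  have htime : 2 * δ < Z.snd ∨ 2 * δ < W.snd := by
    by_contra! hcon
    have hd₁ : dist (spaceIncl d Z.fst) (WithLp.toLp 2 (Z.fst, max Z.snd 0)) < δ₁ := by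
      rw [dist_eq_norm]
      refine lt_of_le_of_lt ?_ (show 3 * δ < δ₁ by linarith)
      refine (abs_le_of_sq_le_sq' ?_ (by positivity)).2
      rw [norm_spaceIncl_sub_toLp_sq, sub_self, norm_zero]
      have h1 : max Z.snd 0 ≤ 2 * δ := max_le hcon.1 (by positivity)
      have h2 : 0 ≤ max Z.snd 0 := le_max_right _ _
      nlinarith
    have hd₂ : dist (spaceIncl d Z.fst) (WithLp.toLp 2 (W.fst, max W.snd 0)) < δ₂ := by
      rw [dist_eq_norm]
      refine lt_of_le_of_lt ?_ (show 3 * δ < δ₂ by linarith)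
      refine (abs_le_of_sq_le_sq' ?_ (by positivity)).2
      rw [norm_spaceIncl_sub_toLp_sq]
      have h1 : max W.snd 0 ≤ 2 * δ := max_le hcon.2 (by positivity)
      have h2 : 0 ≤ max W.snd 0 := le_max_right _ _
      have h3 : ‖Z.fst - W.fst‖ ^ 2 ≤ δ ^ 2 := by gcongr
      nlinarith
    have e₁ : |u₁ Z.fst 0 - u₁ Z.fst (max Z.snd 0)| < θ / 2 := by
      simpa [penalized] using hu₁ _ _ hd₁
    have e₂ : |u₂ Z.fst 0 - u₂ W.fst (max W.snd 0)| < θ / 2 := by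
      simpa [penalized] using hu₂ _ _ hd₂
    have := hinit Z.fst
    have := (abs_lt.1 e₁).1
    have := (abs_lt.1 e₂).1
    linarith
  refine ⟨?_, ?_, ?_, ?_⟩
  · by_contra! hcon
    have h1 := (h₂.2.2.2.1 W.fst (max W.snd 0) (le_max_right _ _)).2.trans (hψ₂ _)
    have h2 := (abs_lt.1 (hm₁ Z.fst W.fst (by linarith))).2
    linarith
  · by_contra! hcon
    have h1 := (h₁.2.2.2.1 Z.fst (max Z.snd 0) (le_max_right _ _)).2.trans (hψ₁ _)
    have h2 := (abs_lt.1 (hm₂ Z.fst W.fst (by linarith))).1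
    linarith
  · have := abs_le.1 hsnd
    rcases htime with h | h <;> linarith
  · have := abs_le.1 hsnd
    rcases htime with h | h <;> linarith

/-- At a maximum point with horizontal slope the kernel is negligible in space. -/
lemma penalized_superjet_of_fst_eq_zero {a : SpaceTime d → ℝ} {L σ : ℝ} {X Z : SpaceTime d}
    (hL : 0 ≤ L) (hσ : 0 < σ)
    (hZ : ∀ Y, a Y - L * quarticKernel (X - Y) ≤ a Z - L * quarticKernel (X - Z))
    (h0 : (X - Z).fst = 0) :
    ∀ᶠ e in 𝓝 0, a (Z + e) ≤ a Z + ⟪-(L • quarticKernelSlope (X - Z)), e⟫ +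
      1 / 2 * ⟪((2 * L) • timeProj d) e, e⟫ + σ * ‖e‖ ^ 2 := by
  have hsmall : ∀ᶠ e in 𝓝 (0 : SpaceTime d), L * ‖e‖ ^ 2 < σ := by
    have : Continuous fun e : SpaceTime d => L * ‖e‖ ^ 2 := by fun_prop
    have := this.tendsto 0
    simp only [norm_zero, ne_eq, OfNat.ofNat_ne_zero, not_false_eq_true, zero_pow, mul_zero] at this
    exact this.eventually_lt_const hσ
  filter_upwards [hsmall] with e he
  have h := hZ (Z + e)
  have h1 := quarticKernel_le (X - (Z + e))
  have h2 : quarticKernel (X - Z) = (X - Z).snd ^ 2 := by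
    simp [quarticKernel, h0]
  have h3 : (X - (Z + e)).fst = -e.fst := by
    rw [show X - (Z + e) = X - Z - e by abel, WithLp.sub_fst, h0, zero_sub]
  have h4 : (X - (Z + e)).snd = (X - Z).snd - e.snd := by
    rw [show X - (Z + e) = X - Z - e by abel, WithLp.sub_snd]
  have h5 : ⟪quarticKernelSlope (X - Z), e⟫ = 2 * (X - Z).snd * e.snd := by
    rw [SpaceTime.inner_eq]
    simp [quarticKernelSlope, h0]
  rw [h3, h4, norm_neg] at h1
  rw [inner_neg_left, real_inner_smul_left, h5, smul_apply, real_inner_smul_left,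
    inner_timeProj_self]
  rw [h2] at h
  have h6 : ‖e.fst‖ ^ 4 ≤ ‖e‖ ^ 2 * ‖e‖ ^ 2 := by
    have : ‖e.fst‖ ^ 4 ≤ ‖e‖ ^ 4 := by gcongr; exact SpaceTime.norm_fst_le e
    linarith [this, show ‖e‖ ^ 4 = ‖e‖ ^ 2 * ‖e‖ ^ 2 by ring]
  have h7 : L * ‖e.fst‖ ^ 4 ≤ σ * ‖e‖ ^ 2 :=
    calc L * ‖e.fst‖ ^ 4 ≤ L * (‖e‖ ^ 2 * ‖e‖ ^ 2) := by gcongr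
      _ = L * ‖e‖ ^ 2 * ‖e‖ ^ 2 := by ring
      _ ≤ σ * ‖e‖ ^ 2 := by gcongr
  have h8 := mul_le_mul_of_nonneg_left h1 hL
  have h9 : 0 ≤ L * ‖e.fst‖ ^ 4 := by positivity
  generalize (X - Z).snd = s at *
  nlinarith

/-- The doubled function has no maximum with non-horizontal slope away from the obstacles. -/
lemma fst_slope_eq_zero_of_max (h₁ : IsViscositySubsol φ₁ ψ₁ u₁)
    (h₂ : IsViscositySubsol φ₂ ψ₂ u₂) {l δ θ L : ℝ} (hl : 0 < l) (hδ : 0 < δ) (hL : 0 ≤ L)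
    {f g : SpaceTime d → ℝ} {p q Z W : SpaceTime d → SpaceTime d}
    (hf : IsSemiconvexSlope L f p) (hg : IsSemiconvexSlope L g q)
    (hjet₁ : ∀ (X : SpaceTime d) (D : SpaceTime d →L[ℝ] SpaceTime d), HasFDerivAt p D X →
      ∀ σ > 0, ∀ᶠ e in 𝓝 0, penalized u₁ l (Z X + e) ≤
      penalized u₁ l (Z X) + ⟪p X, e⟫ + 1 / 2 * ⟪D e, e⟫ + σ * ‖e‖ ^ 2)
    (hjet₂ : ∀ (X : SpaceTime d) (D : SpaceTime d →L[ℝ] SpaceTime d), HasFDerivAt q D X →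
      ∀ σ > 0, ∀ᶠ e in 𝓝 0, penalized u₂ 0 (W X + e) ≤
      penalized u₂ 0 (W X) + ⟪q X, e⟫ + 1 / 2 * ⟪D e, e⟫ + σ * ‖e‖ ^ 2)
    (hgood : ∀ X, θ < f X + g X → φ₁ (Z X).fst < u₁ (Z X).fst (max (Z X).snd 0) ∧
      φ₂ (W X).fst < u₂ (W X).fst (max (W X).snd 0) ∧ δ < (Z X).snd ∧ δ < (W X).snd)
    {X₀ : SpaceTime d} (hX₀ : θ < f X₀ + g X₀) (hmax : ∀ X, f X + g X ≤ f X₀ + g X₀) :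
    (p X₀).fst = 0 := by
  by_contra hne
  obtain ⟨-, hcalm⟩ := hf.eq_and_norm_sub_le (x₀ := X₀) (p₀ := -q X₀) hL hL fun y => by
    have h1 := hmax y
    have h2 := hg X₀ y
    rw [inner_neg_left]
    linarith
  obtain ⟨ρ, hρ, hρe⟩ : ∃ ρ : ℝ, 0 < ρ ∧ ρ = ‖(p X₀).fst‖ := ⟨_, norm_pos_iff.2 hne, rfl⟩
  have hcont : Continuous fun X => f X + g X := hf.continuous.add hg.continuous
  obtain ⟨R, hR, hball⟩ := Metric.eventually_nhds_iff.1 (hcont.continuousAt.eventually_const_lt hX₀)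
  have hev : ∀ F : ℝ → ℝ, Continuous F → ∀ m, F 0 < m → ∀ᶠ τ in 𝓝[>] (0 : ℝ), F τ < m :=
    fun F hF m hm => ((hF.tendsto 0).mono_left nhdsWithin_le_nhds).eventually_lt_const hm
  obtain ⟨τ, hτ, hτR, hτ₁, hτ₂, hτ₃⟩ := ((eventually_mem_nhdsWithin (a := (0 : ℝ)) (s := Set.Ioi 0)).and
    ((hev (fun τ => τ) continuous_id R hR).and
    ((hev (fun τ => 4 * (L + L) * τ) (by fun_prop) (ρ / 4) (by simpa using hρ)).and
    ((hev (fun τ => τ) continuous_id (ρ / 4) (by positivity)).and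
    (hev (fun τ => τ + (2 * τ * d + (2 * τ + 4 * L) * (2 * (4 * τ / ρ) + (4 * τ / ρ) ^ 2)) +
      4 * τ * d) (by fun_prop) (2 * l * δ) (by simp; positivity)))))).exists
  have hτ : 0 < τ := hτ
  obtain ⟨X, ω, D₁, D₂, hX, hω, hpq, hD₁, hD₂, htouch⟩ :=
    hf.exists_hasFDerivAt_near_max hL hg hmax hτ hτ
  obtain ⟨hc₁, hc₂, ht₁, ht₂⟩ := hgood X (hball (by rw [dist_eq_norm]; linarith))
  have hP₁ : ρ / 2 ≤ ‖(p X).fst‖ := by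
    have h1 := (SpaceTime.norm_fst_le (p X - p X₀)).trans (hcalm X)
    rw [WithLp.sub_fst] at h1
    have h2 := abs_le.1 ((abs_norm_sub_norm_le (p X).fst (p X₀).fst).trans h1)
    have h3 : 4 * (L + L) * ‖X - X₀‖ ≤ 4 * (L + L) * τ := by gcongr
    rw [← hρe] at h2
    linarith
  have hsum : ‖(p X).fst + (q X).fst‖ ≤ τ := by
    rw [← WithLp.add_fst, hpq]
    exact (SpaceTime.norm_fst_le ω).trans hω
  have hP₂ : 0 < ‖(q X).fst‖ := by
    have := norm_sub_le ((p X).fst + (q X).fst) (q X).fst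
    rw [add_sub_cancel_right] at this
    linarith
  have hP₁' : 0 < ‖(p X).fst‖ := by linarith
  have hsnd : -τ ≤ (p X).snd + (q X).snd := by
    rw [← WithLp.add_snd, hpq]
    exact (abs_le.1 ((SpaceTime.abs_snd_le ω).trans hω)).1
  obtain ⟨ζ₁, -, hζ₁, hin₁⟩ := h₁.penalized_superjet hτ.le (hδ.trans ht₁) hc₁ (hjet₁ X D₁ hD₁ τ hτ)
  obtain ⟨ζ₂, -, hζ₂, hin₂⟩ := h₂.penalized_superjet hτ.le (hδ.trans ht₂) hc₂ (hjet₂ X D₂ hD₂ τ hτ)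
  have hζ₁ := hζ₁ (norm_pos_iff.1 hP₁')
  have hζ₂ := hζ₂ (norm_pos_iff.1 hP₂)
  have hζ : ‖ζ₁ + ζ₂‖ ≤ 4 * τ / ρ := by
    rw [hζ₁, hζ₂]
    refine (norm_normalize_add_normalize_le (norm_pos_iff.1 hP₁') (norm_pos_iff.1 hP₂) hsum).trans ?_
    rw [div_le_div_iff₀ hP₁' hρ]
    nlinarith
  have hn₁ : ‖ζ₁‖ = 1 := by
    rw [hζ₁, norm_smul, norm_inv, norm_norm, inv_mul_cancel₀ hP₁'.ne']
  have hn₂ : ‖ζ₂‖ = 1 := by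
    rw [hζ₂, norm_smul, norm_inv, norm_norm, inv_mul_cancel₀ hP₂.ne']
  have hcurv := curvature_add_curvature_le hτ.le (by positivity) (hf.neg_le_inner_fderiv hD₁)
    (hg.neg_le_inner_fderiv hD₂) (hf.inner_fderiv_add_le hg hD₁ hD₂ hpq htouch) hn₁ hn₂ hζ
  have hlt : l * δ ≤ l * (Z X).snd := by gcongr
  linarith

/-- The comparison principle for two subsolutions with opposite sign, each of which lies below the
obstacle of the other. -/
theorem IsViscositySubsol.add_nonpos (h₁ : IsViscositySubsol φ₁ ψ₁ u₁)
    (h₂ : IsViscositySubsol φ₂ ψ₂ u₂)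
    (hφ₁ : Continuous φ₁) (hφ₂ : Continuous φ₂) (hp₁ : ZPeriodic φ₁) (hp₂ : ZPeriodic φ₂)
    (hψ₁ : ∀ x, ψ₁ x ≤ -φ₂ x) (hψ₂ : ∀ x, ψ₂ x ≤ -φ₁ x) (hinit : ∀ x, u₁ x 0 + u₂ x 0 ≤ 0)
    (x : EuclideanSpace ℝ (Fin d)) {t : ℝ} (ht : 0 ≤ t) : u₁ x t + u₂ x t ≤ 0 := by
  by_contra! hpos
  obtain ⟨θ, hθ, hθe⟩ : ∃ θ : ℝ, 0 < θ ∧ 4 * θ = u₁ x t + u₂ x t :=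
    ⟨(u₁ x t + u₂ x t) / 4, by positivity, by ring⟩
  obtain ⟨δ, hδ, hsep⟩ := exists_separation h₁ h₂ hφ₁ hφ₂ hp₁ hp₂ hψ₁ hψ₂ hinit hθ
  obtain ⟨M₁, hM₁⟩ := h₁.2.1
  obtain ⟨M₂, hM₂⟩ := h₂.2.1
  have hb₁ : ∀ Y : SpaceTime d, u₁ Y.fst (max Y.snd 0) ≤ M₁ := fun Y =>
    (abs_le.1 (hM₁ _ _ (le_max_right _ _))).2
  have hb₂ : ∀ Y : SpaceTime d, u₂ Y.fst (max Y.snd 0) ≤ M₂ := fun Y =>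
    (abs_le.1 (hM₂ _ _ (le_max_right _ _))).2
  have hM : 0 < M₁ + M₂ := by
    have := (abs_le.1 (hM₁ x t ht)).2
    have := (abs_le.1 (hM₂ x t ht)).2
    linarith
  obtain ⟨l, hl, hlt⟩ : ∃ l : ℝ, 0 < l ∧ l * t ^ 2 ≤ θ := by
    refine ⟨θ / (t ^ 2 + 1), by positivity, ?_⟩
    rw [div_mul_eq_mul_div, div_le_iff₀ (by positivity)]
    nlinarith
  obtain ⟨ε, hε, hεδ⟩ : ∃ ε : ℝ, 0 < ε ∧ 2 * ε + 2 * ε ^ 2 ≤ (δ / 2) ^ 2 := by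
    refine ⟨min 1 (δ ^ 2 / 16), by positivity, ?_⟩
    have h1 : min 1 (δ ^ 2 / 16) ≤ 1 := min_le_left _ _
    have h2 : min 1 (δ ^ 2 / 16) ≤ δ ^ 2 / 16 := min_le_right _ _
    have h3 : 0 < min 1 (δ ^ 2 / 16) := by positivity
    nlinarith
  obtain ⟨L, hL, hLM⟩ : ∃ L : ℝ, 0 < L ∧ M₁ + M₂ ≤ L * ε ^ 2 :=
    ⟨(M₁ + M₂) / ε ^ 2, by positivity, by field_simp; exact le_rfl⟩
  have ha₁ : ∀ Y, penalized u₁ l Y ≤ M₁ := fun Y =>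
    (sub_le_self _ (by positivity)).trans (hb₁ Y)
  have ha₂ : ∀ Y, penalized u₂ 0 Y ≤ M₂ := fun Y =>
    (sub_le_self _ (by rw [zero_mul])).trans (hb₂ Y)
  choose Z hZ using fun X =>
    exists_forall_sub_quarticKernel_le (h₁.continuous_penalized l) ha₁ hL X
  choose W hW using fun X =>
    exists_forall_sub_quarticKernel_le (h₂.continuous_penalized 0) ha₂ hL X
  have hf := isSemiconvexSlope_supConvolution hL.le hZ
  have hg := isSemiconvexSlope_supConvolution hL.le hW
  have hnear : ∀ X Y : SpaceTime d, L * quarticKernel (X - Y) ≤ M₁ + M₂ → ‖X - Y‖ ≤ δ / 2 := by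
    intro X Y h
    have h1 := norm_sq_le_of_quarticKernel_le hε.le (le_of_mul_le_mul_left (h.trans hLM) hL)
    exact (abs_le_of_sq_le_sq' (h1.trans hεδ) (by positivity)).2
  have hgood : ∀ X : SpaceTime d, θ < (penalized u₁ l (Z X) - L * quarticKernel (X - Z X)) +
      (penalized u₂ 0 (W X) - L * quarticKernel (X - W X)) →
      φ₁ (Z X).fst < u₁ (Z X).fst (max (Z X).snd 0) ∧
      φ₂ (W X).fst < u₂ (W X).fst (max (W X).snd 0) ∧ δ < (Z X).snd ∧ δ < (W X).snd ∧
      |X.snd| ≤ (M₁ + M₂) / l + 1 + δ := by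
    intro X hX
    have hk₁ := mul_nonneg hL.le (quarticKernel_nonneg (X - Z X))
    have hk₂ := mul_nonneg hL.le (quarticKernel_nonneg (X - W X))
    have hXZ : ‖X - Z X‖ ≤ δ / 2 := hnear _ _ (by linarith [ha₁ (Z X), ha₂ (W X)])
    have hXW : ‖X - W X‖ ≤ δ / 2 := hnear _ _ (by linarith [ha₁ (Z X), ha₂ (W X)])
    have hdist : dist (Z X) (W X) ≤ δ := by
      have := dist_triangle_left (Z X) (W X) X
      rw [dist_eq_norm X, dist_eq_norm X] at this
      linarith
    have hsq : 0 ≤ l * (Z X).snd ^ 2 := by positivity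
    simp only [penalized, zero_mul, sub_zero] at hX
    obtain ⟨h1, h2, h3, h4⟩ := hsep (Z X) (W X) hdist (by linarith)
    refine ⟨h1, h2, h3, h4, ?_⟩
    have h5 : (Z X).snd ^ 2 ≤ (M₁ + M₂) / l := by
      rw [le_div_iff₀ hl]
      linarith [hb₁ (Z X), hb₂ (W X)]
    have h6 := (SpaceTime.abs_snd_le (X - Z X)).trans hXZ
    rw [WithLp.sub_snd] at h6
    have h7 : (Z X).snd ≤ (Z X).snd ^ 2 + 1 := by nlinarith
    rw [abs_le] at h6 ⊢
    constructor <;> linarith [h6.1, h6.2, div_pos hM hl]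
  have hstart : 3 * θ ≤ (penalized u₁ l (Z (WithLp.toLp 2 (x, t))) -
        L * quarticKernel (WithLp.toLp 2 (x, t) - Z (WithLp.toLp 2 (x, t)))) +
      (penalized u₂ 0 (W (WithLp.toLp 2 (x, t))) -
        L * quarticKernel (WithLp.toLp 2 (x, t) - W (WithLp.toLp 2 (x, t)))) := by
    have e₁ := hZ (WithLp.toLp 2 (x, t)) (WithLp.toLp 2 (x, t))
    have e₂ := hW (WithLp.toLp 2 (x, t)) (WithLp.toLp 2 (x, t))
    rw [sub_self, quarticKernel_zero, mul_zero, sub_zero] at e₁ e₂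
    have e₃ : penalized u₁ l (WithLp.toLp 2 (x, t)) = u₁ x t - l * t ^ 2 := by
      simp [penalized, max_eq_left ht]
    have e₄ : penalized u₂ 0 (WithLp.toLp 2 (x, t)) = u₂ x t := by
      simp [penalized, max_eq_left ht]
    linarith
  obtain ⟨X₀, hX₀⟩ := exists_forall_ge_of_periodic (hf.continuous.add hg.continuous)
    (fun X k => congrArg₂ (· + ·)
      (supConvolution_add hZ (fun Y => h₁.penalized_add_latticeVec l Y k) X)
      (supConvolution_add hW (fun Y => h₂.penalized_add_latticeVec 0 Y k) X))
    (m := 3 * θ) (fun X hX => (hgood X (lt_of_lt_of_le (by linarith) hX)).2.2.2.2) hstart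
  simp only [Pi.add_apply] at hX₀
  have hX₀θ := lt_of_lt_of_le (show θ < 3 * θ by linarith) (hstart.trans (hX₀ _))
  have hzero := fst_slope_eq_zero_of_max h₁ h₂ hl hδ hL.le hf hg
    (fun X D hD σ hσ => supConvolution_superjet hL.le hZ hD hσ)
    (fun X D hD σ hσ => supConvolution_superjet hL.le hW hD hσ)
    (fun X hX => ⟨(hgood X hX).1, (hgood X hX).2.1, (hgood X hX).2.2.1, (hgood X hX).2.2.2.1⟩)
    hX₀θ hX₀
  have hpq : -(L • quarticKernelSlope (X₀ - Z X₀)) = - -(L • quarticKernelSlope (X₀ - W X₀)) :=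
    (hf.eq_and_norm_sub_le (x₀ := X₀) hL.le hL.le fun y => by
      have h1 := hX₀ y
      have h2 := hg X₀ y
      rw [inner_neg_left]
      dsimp only at h1 h2 ⊢
      linarith).1
  have hslope : ∀ Y : SpaceTime d, (-(L • quarticKernelSlope (X₀ - Y))).fst = 0 →
      (X₀ - Y).fst = 0 := by
    intro Y hY
    refine fst_eq_zero_of_quarticKernelSlope ?_
    rw [WithLp.neg_fst, WithLp.smul_fst, neg_eq_zero] at hY
    exact (smul_eq_zero.1 hY).resolve_left hL.ne'
  have hzero' : (-(L • quarticKernelSlope (X₀ - W X₀))).fst = 0 := by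
    rw [hpq, WithLp.neg_fst, neg_eq_zero] at hzero
    exact hzero
  obtain ⟨hc₁, hc₂, ht₁, ht₂, -⟩ := hgood X₀ hX₀θ
  obtain ⟨σ, hσ, hσl⟩ : ∃ σ : ℝ, 0 < σ ∧ 4 * σ * d < 2 * l * δ := by
    refine ⟨l * δ / (2 * (d + 1)), by positivity, ?_⟩
    have : 4 * (l * δ / (2 * (d + 1))) * (d : ℝ) = 2 * l * δ * (d / (d + 1)) := by
      field_simp
      ring
    rw [this]
    refine mul_lt_of_lt_one_right (by positivity) ?_
    rw [div_lt_one (by positivity)]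
    linarith
  obtain ⟨ζ₁, -, -, hin₁⟩ := h₁.penalized_superjet hσ.le (hδ.trans ht₁) hc₁
    (penalized_superjet_of_fst_eq_zero hL.le hσ (hZ X₀) (hslope _ hzero))
  obtain ⟨ζ₂, -, -, hin₂⟩ := h₂.penalized_superjet hσ.le (hδ.trans ht₂) hc₂
    (penalized_superjet_of_fst_eq_zero hL.le hσ (hW X₀) (hslope _ hzero'))
  rw [spatialTrace_smul, spatialTrace_timeProj, smul_apply, timeProj_spaceIncl, smul_zero,
    inner_zero_left] at hin₁ hin₂
  rw [hpq, WithLp.neg_snd] at hin₁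
  have : l * δ < l * (Z X₀).snd := by gcongr
  linarith

end Doubling

/-- Comparison principle for the obstacle level-set flow. -/
theorem comparison_principle_obstacle_levelset_flow
    (φ ψ : EuclideanSpace ℝ (Fin d) → ℝ)
    (hφ : ContDiff ℝ 1 φ) (hψ : ContDiff ℝ 1 ψ)
    (hφp : ZPeriodic φ) (hψp : ZPeriodic ψ)
    (hlt : ∀ x, φ x < ψ x)
    (u v : EuclideanSpace ℝ (Fin d) → ℝ → ℝ)
    (hu : IsViscositySubsol φ ψ u) (hv : IsViscositySupersol φ ψ v)
    (hinit : ∀ x, u x 0 ≤ v x 0) :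
    ∀ (x : EuclideanSpace ℝ (Fin d)) (t : ℝ), 0 ≤ t → u x t ≤ v x t := by
  intro x t ht
  have h := hu.add_nonpos hv.neg hφ.continuous hψ.continuous.neg hφp
    (fun x k => congrArg Neg.neg (hψp x k)) (fun x => (neg_neg _).ge) (fun x => le_rfl)
    (fun x => by linarith [hinit x]) x ht
  linarith
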